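/- arXiv:2602.01336 — 2 statements merged into one kernel-verified Lean document; each statement's English description precedes it below -/
import Mathlib

section
/- Let 2 < q < p < 6 and μ > 0, and define ᾱ := inf{α < 0 : 𝓔_{p,q,α}(μ) < 0}. Then: (i) −∞ < ᾱ < 0; (ii) for every α ∈ (ᾱ, 0), 𝓔_{p,q,α}(μ) < 0 and there exists a ground state of mass μ for E_{p,q,α}; (iii) 𝓔_{p,q,ᾱ}(μ) = 0 and there exists a ground state of mass μ for E_{p,q,ᾱ}; (iv) for every α < ᾱ, 𝓔_{p,q,α}(μ) = 0 and no ground state of mass μ for E_{p,q,α} exists. -/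
open MeasureTheory

/-- The NLS energy with combined nonlinearities on the real line. -/
noncomputable def NLSenergy (p q α : ℝ) (u : ℝ → ℝ) : ℝ :=
  ∫ x : ℝ, ((1 / 2) * (deriv u x) ^ 2 - (1 / p) * |u x| ^ p - (α / q) * |u x| ^ q)

/-- Membership in H¹_μ(ℝ): differentiable, u and u′ square-integrable, mass μ. -/
def InH1mass (μ : ℝ) (u : ℝ → ℝ) : Prop :=
  Differentiable ℝ u ∧ (Integrable fun x => (u x) ^ 2) ∧
    (Integrable fun x => (deriv u x) ^ 2) ∧ (∫ x : ℝ, (u x) ^ 2) = μ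

/-- The ground-state energy level 𝓔_{p,q,α}(μ), as an extended real number. -/
noncomputable def groundLevel (p q α μ : ℝ) : EReal :=
  sInf ((fun u : ℝ → ℝ => ((NLSenergy p q α u : ℝ) :  EReal)) '' {u | InH1mass μ u})

/-- The critical mass of the real line: μ_ℝ = (√3/2)π. -/
noncomputable def muR : ℝ := Real.sqrt 3 / 2 * Real.pi

open Set Filter Topology

section Calibration

variable {H v : ℝ → ℝ} {μ l x₀ : ℝ}

/-- The primitive `∫₀ᴺ √(l - H r) dr`, whose composition with `u²` calibrates the energy. -/
noncomputable def calib (H : ℝ → ℝ) (l N : ℝ) : ℝ := ∫ r in (0 : ℝ)..N, √(l - H r)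

/-- The action density `u'² + u² (l - H (u²))`. -/
noncomputable def actionDensity (H : ℝ → ℝ) (l : ℝ) (u : ℝ → ℝ) (x : ℝ) : ℝ :=
  deriv u x ^ 2 + u x ^ 2 * (l - H (u x ^ 2))

lemma hasDerivAt_calib (hH : Continuous H) (l N : ℝ) :
    HasDerivAt (calib H l) (√(l - H N)) N :=
  (Continuous.integral_hasStrictDerivAt (by fun_prop) 0 N).hasDerivAt

lemma InH1mass.hasDerivAt_sq (hv : InH1mass μ v) (x : ℝ) :
    HasDerivAt (fun x => v x ^ 2) (2 * v x * deriv v x) x := by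
  have h := (hv.1 x).hasDerivAt.fun_pow 2
  simpa using h

lemma InH1mass.integrable_mul_deriv (hv : InH1mass μ v) :
    Integrable fun x => 2 * v x * deriv v x := by
  refine (hv.2.1.add hv.2.2.1).mono' ?_ (ae_of_all _ fun x => ?_)
  · exact ((hv.1.continuous.measurable.const_mul 2).mul (measurable_deriv v)).aestronglyMeasurable
  · simp only [Real.norm_eq_abs, Pi.add_apply]
    rw [abs_le]
    constructor <;> nlinarith [sq_nonneg (v x + deriv v x), sq_nonneg (v x - deriv v x)]

lemma InH1mass.comp_neg (hv : InH1mass μ v) : InH1mass μ fun x => v (-x) := by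
  refine ⟨hv.1.comp differentiable_neg, hv.2.1.comp_neg, ?_, ?_⟩
  · simpa [deriv_comp_neg] using hv.2.2.1.comp_neg
  · rw [← hv.2.2.2]
    exact integral_neg_eq_self (fun x => v x ^ 2) volume

lemma InH1mass.tendsto_sq_atTop (hv : InH1mass μ v) :
    Tendsto (fun x => v x ^ 2) atTop (𝓝 0) :=
  tendsto_zero_of_hasDerivAt_of_integrableOn_Ioi (a := 0) (fun x _ => hv.hasDerivAt_sq x)
    hv.integrable_mul_deriv.integrableOn hv.2.1.integrableOn

lemma InH1mass.tendsto_sq_atBot (hv : InH1mass μ v) :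
    Tendsto (fun x => v x ^ 2) atBot (𝓝 0) := by
  simpa [Function.comp_def] using hv.comp_neg.tendsto_sq_atTop.comp tendsto_neg_atBot_atTop

lemma InH1mass.exists_ne_zero (hμ : 0 < μ) (hv : InH1mass μ v) : ∃ x, v x ≠ 0 := by
  by_contra! h
  have := hv.2.2.2
  simp [h] at this
  exact hμ.ne this

lemma InH1mass.exists_max (hμ : 0 < μ) (hv : InH1mass μ v) :
    ∃ x₀, v x₀ ≠ 0 ∧ ∀ x, v x ^ 2 ≤ v x₀ ^ 2 := by
  obtain ⟨x₁, h₁⟩ := hv.exists_ne_zero hμ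
  have hpos : 0 < v x₁ ^ 2 := by positivity
  obtain ⟨x₀, h₀⟩ := (hv.1.continuous.pow 2).exists_forall_ge' x₁ (by
    rw [cocompact_eq_atBot_atTop, eventually_sup]
    exact ⟨(hv.tendsto_sq_atBot.eventually_lt_const hpos).mono fun _ h => h.le,
      (hv.tendsto_sq_atTop.eventually_lt_const hpos).mono fun _ h => h.le⟩)
  refine ⟨x₀, fun h => ?_, h₀⟩
  have := h₀ x₁
  simp only [Pi.pow_apply, h] at this
  linarith

lemma InH1mass.integrable_sq_mul (hμ : 0 < μ) (hv : InH1mass μ v) {g : ℝ → ℝ}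
    (hg : Continuous g) : Integrable fun x => v x ^ 2 * g (v x ^ 2) := by
  obtain ⟨x₀, -, h₀⟩ := hv.exists_max hμ
  obtain ⟨C, hC⟩ := (isCompact_Icc (a := 0) (b := v x₀ ^ 2)).exists_bound_of_continuousOn
    hg.continuousOn
  refine hv.2.1.mul_bdd (c := C) ?_ (ae_of_all _ fun x => hC _ ⟨sq_nonneg _, h₀ x⟩)
  exact (hg.comp (hv.1.continuous.pow 2)).aestronglyMeasurable

lemma InH1mass.integrable_actionDensity (hμ : 0 < μ) (hH : Continuous H) (hv : InH1mass μ v)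
    (l : ℝ) : Integrable (actionDensity H l v) :=
  hv.2.2.1.add (hv.integrable_sq_mul hμ (g := fun r => l - H r) (by fun_prop))

lemma integral_actionDensity_of_calib (hH : Continuous H) (hv : InH1mass μ v)
    (hint : IntegrableOn (fun x => √(l - H (v x ^ 2)) * (2 * v x * deriv v x)) (Ioi x₀)) :
    ∫ x in Ioi x₀, √(l - H (v x ^ 2)) * (2 * v x * deriv v x) = - calib H l (v x₀ ^ 2) := by
  have h0 : calib H l 0 = 0 := by simp [calib]
  have hd : ∀ x, HasDerivAt (fun x => calib H l (v x ^ 2))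
      (√(l - H (v x ^ 2)) * (2 * v x * deriv v x)) x := fun x =>
    HasDerivAt.comp (h₂ := calib H l) x (hasDerivAt_calib hH l (v x ^ 2)) (hv.hasDerivAt_sq x)
  have := integral_Ioi_of_hasDerivAt_of_tendsto' (a := x₀) (fun x _ => hd x) hint
    (m := 0) (by
      rw [← h0]
      exact (hasDerivAt_calib hH l 0).continuousAt.tendsto.comp hv.tendsto_sq_atTop)
  simpa using this

lemma calib_le_setIntegral_Ioi (hμ : 0 < μ) (hH : Continuous H) (hv : InH1mass μ v)
    (hl : ∀ x ∈ Ioi x₀, H (v x ^ 2) ≤ l) :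
    calib H l (v x₀ ^ 2) ≤ ∫ x in Ioi x₀, actionDensity H l v x := by
  have key : ∀ x ∈ Ioi x₀,
      |√(l - H (v x ^ 2)) * (2 * v x * deriv v x)| ≤ actionDensity H l v x := by
    intro x hx
    have h := Real.sq_sqrt (sub_nonneg.2 (hl x hx))
    have e : actionDensity H l v x =
        deriv v x ^ 2 + (v x * √(l - H (v x ^ 2))) ^ 2 := by
      rw [mul_pow, h, actionDensity]
    rw [e, abs_le]
    constructor <;> nlinarith [sq_nonneg (deriv v x + v x * √(l - H (v x ^ 2))),
      sq_nonneg (deriv v x - v x * √(l - H (v x ^ 2)))]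
  have hA := (hv.integrable_actionDensity hμ hH l).integrableOn (s := Ioi x₀)
  have hint : IntegrableOn (fun x => √(l - H (v x ^ 2)) * (2 * v x * deriv v x)) (Ioi x₀) := by
    refine hA.mono' ?_ ((ae_restrict_iff' measurableSet_Ioi).2 (ae_of_all _ key))
    have hc := hv.1.continuous
    exact ((by fun_prop : Continuous fun x => √(l - H (v x ^ 2)) * (2 * v x)).measurable.mul
      (measurable_deriv v)).aestronglyMeasurable.congr (ae_of_all _ fun x => by simp; ring)
  rw [← neg_neg (calib H l (v x₀ ^ 2)), ← integral_actionDensity_of_calib hH hv hint,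
    ← integral_neg]
  exact setIntegral_mono_on hint.neg hA measurableSet_Ioi
    fun x hx => (neg_le_abs _).trans (key x hx)

lemma actionDensity_comp_neg (x : ℝ) :
    actionDensity H l (fun x => v (-x)) x = actionDensity H l v (-x) := by
  simp [actionDensity, deriv_comp_neg]

lemma calib_le_setIntegral_Iic (hμ : 0 < μ) (hH : Continuous H) (hv : InH1mass μ v)
    (hl : ∀ x ∈ Iio x₀, H (v x ^ 2) ≤ l) :
    calib H l (v x₀ ^ 2) ≤ ∫ x in Iic x₀, actionDensity H l v x := by
  have := calib_le_setIntegral_Ioi (x₀ := -x₀) (l := l) hμ hH hv.comp_neg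
    fun x hx => hl _ (by simpa [neg_lt] using hx)
  simp only [actionDensity_comp_neg, neg_neg] at this
  rwa [integral_comp_neg_Ioi (-x₀) (actionDensity H l v), neg_neg] at this

lemma two_mul_calib_le (hμ : 0 < μ) (hH : Continuous H) (hv : InH1mass μ v)
    (hl : ∀ x, H (v x ^ 2) ≤ l) :
    2 * calib H l (v x₀ ^ 2) ≤ ∫ x, actionDensity H l v x := by
  have h1 := calib_le_setIntegral_Ioi (x₀ := x₀) hμ hH hv fun x _ => hl x
  have h2 := calib_le_setIntegral_Iic (x₀ := x₀) hμ hH hv fun x _ => hl x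
  have hA := hv.integrable_actionDensity hμ hH l
  rw [← intervalIntegral.integral_Iic_add_Ioi (b := x₀) hA.integrableOn hA.integrableOn]
  linarith

end Calibration

section Potential

variable {p q α μ r N : ℝ} {v : ℝ → ℝ}

/-- The function `H` for which the potential part of the energy density is `u² H(u²) / 2`. -/
noncomputable def nlsPot (p q α r : ℝ) : ℝ :=
  2 / p * r ^ ((p - 2) / 2) + 2 * α / q * r ^ ((q - 2) / 2)

lemma continuous_nlsPot_uncurry (hq : 2 < q) (hqp : q < p) :
    Continuous fun z : ℝ × ℝ => nlsPot p q z.1 z.2 := by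
  have h1 := Real.continuous_rpow_const (q := (p - 2) / 2) (by linarith)
  have h2 := Real.continuous_rpow_const (q := (q - 2) / 2) (by linarith)
  unfold nlsPot
  exact (continuous_const.mul (h1.comp continuous_snd)).add
    (((continuous_const.mul continuous_fst).div_const q).mul (h2.comp continuous_snd))

lemma continuous_nlsPot (hq : 2 < q) (hqp : q < p) (α : ℝ) : Continuous (nlsPot p q α) :=
  (continuous_nlsPot_uncurry hq hqp).comp (by fun_prop : Continuous fun r : ℝ => (α, r))

lemma nlsPot_zero (hq : 2 < q) (hqp : q < p) : nlsPot p q α 0 = 0 := by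
  simp [nlsPot, Real.zero_rpow (by linarith : (p - 2) / 2 ≠ 0),
    Real.zero_rpow (by linarith : (q - 2) / 2 ≠ 0)]

/-- The nonnegativity of this quantity characterizes the region where `nlsPot` is nonnegative. -/
noncomputable def nlsExcess (p q α r : ℝ) : ℝ := 2 / p * r ^ ((p - q) / 2) + 2 * α / q

lemma continuous_nlsExcess_uncurry (hqp : q < p) :
    Continuous fun z : ℝ × ℝ => nlsExcess p q z.1 z.2 := by
  have h1 := Real.continuous_rpow_const (q := (p - q) / 2) (by linarith)
  unfold nlsExcess
  exact (continuous_const.mul (h1.comp continuous_snd)).add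
    ((continuous_const.mul continuous_fst).div_const q)

lemma nlsPot_eq (hr : 0 < r) :
    nlsPot p q α r = r ^ ((q - 2) / 2) * nlsExcess p q α r := by
  have : r ^ ((p - 2) / 2) = r ^ ((q - 2) / 2) * r ^ ((p - q) / 2) := by
    rw [← Real.rpow_add hr]; congr 1; ring
  rw [nlsPot, nlsExcess, this]; ring

lemma nlsExcess_mono (hq : 2 < q) (hqp : q < p) (hr : 0 ≤ r) (hrN : r ≤ N) :
    nlsExcess p q α r ≤ nlsExcess p q α N := by
  have hp0 : 0 < p := by linarith
  have h1 := Real.rpow_le_rpow hr hrN (by linarith : 0 ≤ (p - q) / 2)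
  unfold nlsExcess
  gcongr

lemma nlsExcess_strictMono (hq : 2 < q) (hqp : q < p) (hr : 0 ≤ r) (hrN : r < N) :
    nlsExcess p q α r < nlsExcess p q α N := by
  have hp0 : 0 < p := by linarith
  have h1 := Real.rpow_lt_rpow hr hrN (by linarith : 0 < (p - q) / 2)
  unfold nlsExcess
  gcongr

lemma nlsPot_le_rpow_mul (hq : 2 < q) (hqp : q < p) (hN : 0 < N) (hr : 0 ≤ r) (hrN : r ≤ N) :
    nlsPot p q α r ≤ (r / N) ^ ((q - 2) / 2) * nlsPot p q α N := by
  rcases hr.eq_or_lt with rfl | hr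
  · rw [nlsPot_zero hq hqp, zero_div, Real.zero_rpow (by linarith), zero_mul]
  rw [nlsPot_eq hr, nlsPot_eq hN, ← mul_assoc, ← Real.mul_rpow (by positivity) hN.le,
    div_mul_cancel₀ _ hN.ne']
  gcongr
  exact nlsExcess_mono hq hqp hr.le hrN

lemma nlsPot_lt (hq : 2 < q) (hqp : q < p) (hN : 0 < N) (hr : 0 ≤ r) (hrN : r < N)
    (hpos : 0 < nlsPot p q α N) : nlsPot p q α r < nlsPot p q α N := by
  have h1 : (r / N) ^ ((q - 2) / 2) < 1 :=
    Real.rpow_lt_one (by positivity) ((div_lt_one hN).2 hrN) (by linarith)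
  nlinarith [nlsPot_le_rpow_mul (α := α) hq hqp hN hr hrN.le]

lemma nlsPot_le (hq : 2 < q) (hqp : q < p) (hN : 0 < N) (hr : 0 ≤ r) (hrN : r ≤ N)
    (hpos : 0 ≤ nlsPot p q α N) : nlsPot p q α r ≤ nlsPot p q α N := by
  have h1 : (r / N) ^ ((q - 2) / 2) ≤ 1 :=
    Real.rpow_le_one (by positivity) ((div_le_one hN).2 hrN) (by linarith)
  nlinarith [nlsPot_le_rpow_mul (α := α) hq hqp hN hr hrN]

lemma nlsPot_nonpos (hq : 2 < q) (hqp : q < p) (hN : 0 < N) (hr : 0 ≤ r) (hrN : r ≤ N)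
    (hneg : nlsPot p q α N ≤ 0) : nlsPot p q α r ≤ 0 :=
  (nlsPot_le_rpow_mul hq hqp hN hr hrN).trans
    (mul_nonpos_of_nonneg_of_nonpos (by positivity) hneg)

lemma exists_hasDerivAt_nlsPot (hq : 2 < q) (hqp : q < p) (hN : 0 < N)
    (hpos : 0 < nlsPot p q α N) : ∃ d, 0 < d ∧ HasDerivAt (nlsPot p q α) d N := by
  have h1 := (Real.hasDerivAt_rpow_const (p := (p - 2) / 2) (Or.inl hN.ne')).const_mul (2 / p)
  have h2 := (Real.hasDerivAt_rpow_const (p := (q - 2) / 2) (Or.inl hN.ne')).const_mul (2 * α / q)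
  refine ⟨_, ?_, h1.add h2⟩
  rw [Real.rpow_sub_one hN.ne', Real.rpow_sub_one hN.ne']
  have hp0 : 0 < p := by linarith
  have e : 2 / p * ((p - 2) / 2 * (N ^ ((p - 2) / 2) / N)) +
      2 * α / q * ((q - 2) / 2 * (N ^ ((q - 2) / 2) / N)) =
      ((q - 2) / 2 * nlsPot p q α N + (p - q) / 2 * (2 / p * N ^ ((p - 2) / 2))) / N := by
    rw [nlsPot]; ring
  rw [e]
  have : 0 < q - 2 := by linarith
  have : 0 < p - q := by linarith
  positivity

lemma abs_rpow_eq_sq_mul (hq : 2 < q) (s : ℝ) : |s| ^ q = s ^ 2 * (s ^ 2) ^ ((q - 2) / 2) := by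
  rw [← sq_abs s, ← Real.rpow_natCast, ← Real.rpow_mul (abs_nonneg s),
    ← Real.rpow_add_of_nonneg (abs_nonneg s) (by simp) (by push_cast; linarith)]
  congr 1; push_cast; ring

lemma InH1mass.integrable_abs_rpow (hμ : 0 < μ) (hv : InH1mass μ v) (hq : 2 < q) :
    Integrable fun x => |v x| ^ q := by
  simp_rw [abs_rpow_eq_sq_mul hq]
  exact hv.integrable_sq_mul hμ (Real.continuous_rpow_const (by linarith))

lemma InH1mass.integral_abs_rpow_pos (hμ : 0 < μ) (hv : InH1mass μ v) (hq : 2 < q) :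
    0 < ∫ x, |v x| ^ q := by
  obtain ⟨x₀, h₀⟩ := hv.exists_ne_zero hμ
  have hc : Continuous fun x => |v x| ^ q :=
    hv.1.continuous.abs.rpow_const fun _ => Or.inr (by linarith)
  rw [integral_pos_iff_support_of_nonneg (fun x => by positivity) (hv.integrable_abs_rpow hμ hq)]
  refine hc.isOpen_support.measure_pos _ ⟨x₀, ?_⟩
  have : 0 < |v x₀| ^ q := by positivity
  exact this.ne'

lemma NLSenergy_eq (hμ : 0 < μ) (hv : InH1mass μ v) (hq : 2 < q) (hqp : q < p) (α : ℝ) :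
    NLSenergy p q α v = 1 / 2 * (∫ x, deriv v x ^ 2) - 1 / p * (∫ x, |v x| ^ p)
      - α / q * ∫ x, |v x| ^ q := by
  have h1 := hv.2.2.1.const_mul (1 / 2)
  have h2 := (hv.integrable_abs_rpow hμ (hq.trans hqp)).const_mul (1 / p)
  have h3 := (hv.integrable_abs_rpow hμ hq).const_mul (α / q)
  have h12 : Integrable fun x => 1 / 2 * deriv v x ^ 2 - 1 / p * |v x| ^ p := h1.sub h2
  rw [NLSenergy, integral_sub h12 h3, integral_sub h1 h2, integral_const_mul,
    integral_const_mul, integral_const_mul]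

lemma integral_actionDensity_nlsPot (hμ : 0 < μ) (hv : InH1mass μ v) (hq : 2 < q) (hqp : q < p)
    (α l : ℝ) :
    ∫ x, actionDensity (nlsPot p q α) l v x = 2 * NLSenergy p q α v + l * μ := by
  rw [NLSenergy, ← hv.2.2.2, ← integral_const_mul, ← integral_const_mul, ← integral_add]
  · congr 1; ext x
    rw [actionDensity, nlsPot, abs_rpow_eq_sq_mul hq, abs_rpow_eq_sq_mul (hq.trans hqp)]
    ring
  · exact (((hv.2.2.1.const_mul _).sub ((hv.integrable_abs_rpow hμ (hq.trans hqp)).const_mul _)).sub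
      ((hv.integrable_abs_rpow hμ hq).const_mul _)).const_mul 2
  · exact hv.2.1.const_mul l

end Potential

section Soliton

variable {H : ℝ → ℝ} {N d : ℝ}

lemma exists_odd_flow {g : ℝ → ℝ} {C : ℝ} (hg : Continuous g) (heven : ∀ y, g (-y) = g y)
    (hpos : ∀ y, 0 < g y) (hC : ∀ y, g y ≤ C) :
    ∃ Y : ℝ → ℝ, (∀ x, HasDerivAt Y (g (Y x)) x) ∧ ∀ x, Y (-x) = -Y x := by
  have hCpos : 0 < C := (hpos 0).trans_le (hC 0)
  have hgi : Continuous fun y => (g y)⁻¹ := hg.inv₀ fun y => (hpos y).ne'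
  set X : ℝ → ℝ := fun y => ∫ t in (0 : ℝ)..y, (g t)⁻¹ with hX
  have hXd : ∀ y, HasDerivAt X (g y)⁻¹ y := fun y =>
    (hgi.integral_hasStrictDerivAt 0 y).hasDerivAt
  have hXodd : ∀ y, X (-y) = -X y := by
    intro y
    have := intervalIntegral.integral_comp_neg (a := 0) (b := y) fun t => (g t)⁻¹
    simp only [heven, neg_zero] at this
    rw [hX]
    simp only
    rw [this, intervalIntegral.integral_symm]
  have hXmono : StrictMono X := strictMono_of_deriv_pos fun y => by
    rw [(hXd y).deriv]; exact inv_pos.2 (hpos y)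
  have hX0 : X 0 = 0 := by simp [hX]
  have hlow : ∀ y, 0 ≤ y → y / C ≤ X y := by
    have hm : Monotone fun y => X y - y / C := by
      have hd : ∀ y, HasDerivAt (fun y => X y - y / C) ((g y)⁻¹ - 1 / C) y := fun y =>
        (hXd y).sub ((hasDerivAt_id y).div_const C)
      refine monotone_of_deriv_nonneg (fun y => (hd y).differentiableAt) fun y => ?_
      rw [(hd y).deriv, sub_nonneg, one_div]
      exact inv_anti₀ (hpos y) (hC y)
    intro y hy
    have := hm hy
    simp only [hX0, zero_div, sub_zero] at this
    linarith
  have htop : Tendsto X atTop atTop :=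
    tendsto_atTop_mono' _ ((eventually_ge_atTop 0).mono hlow) (tendsto_id.atTop_div_const hCpos)
  have hbot : Tendsto X atBot atBot := by
    have := tendsto_neg_atTop_atBot.comp (htop.comp tendsto_neg_atBot_atTop)
    simpa [Function.comp_def, hXodd] using this
  have hXc : Continuous X := continuous_iff_continuousAt.2 fun y => (hXd y).continuousAt
  let e := hXmono.orderIsoOfSurjective X (hXc.surjective htop hbot)
  have hXe : ∀ x, X (e.symm x) = x := fun x => e.apply_symm_apply x
  refine ⟨e.symm, fun x => ?_, fun x => ?_⟩
  · simpa using HasDerivAt.of_local_left_inverse (f := X) e.symm.continuous.continuousAt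
      (hXd (e.symm x)) (inv_pos.2 (hpos _)).ne' (Eventually.of_forall hXe)
  · apply hXmono.injective
    rw [hXe, hXodd, hXe]

lemma hasDerivAt_sinh_div_cosh (y : ℝ) :
    HasDerivAt (fun y => Real.sinh y / Real.cosh y) (1 / Real.cosh y ^ 2) y := by
  refine ((Real.hasDerivAt_sinh y).fun_div (Real.hasDerivAt_cosh y)
    (Real.cosh_pos y).ne').congr_deriv ?_
  congr 1
  linarith [Real.cosh_sq y]

lemma integrable_of_even {f : ℝ → ℝ} (heven : ∀ x, f (-x) = f x)
    (hf : IntegrableOn f (Ioi 0)) : Integrable f := by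
  have h : IntegrableOn f (Iic 0) := by
    rw [integrableOn_Iic_iff_integrableOn_Iio]
    have := ((Measure.measurePreserving_neg (volume : Measure ℝ)).integrableOn_comp_preimage
      (Homeomorph.neg ℝ).measurableEmbedding).2 hf
    simpa [Function.comp_def, heven] using this
  rw [← integrableOn_univ, ← Iic_union_Ioi (a := (0 : ℝ))]
  exact h.union hf

/-- An even, positive, stationary profile with maximum `√N` of some mass `m`. -/
structure IsProfile (H : ℝ → ℝ) (N m : ℝ) (u : ℝ → ℝ) : Prop where
  inH1mass : InH1mass m u
  even : ∀ x, u (-x) = u x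
  pos : ∀ x, 0 < u x
  sq_zero : u 0 ^ 2 = N
  sq_lt : ∀ x, 0 < x → u x ^ 2 < N
  deriv_nonpos : ∀ x, 0 ≤ x → deriv u x ≤ 0
  deriv_sq : ∀ x, deriv u x ^ 2 = u x ^ 2 * (H N - H (u x ^ 2))

lemma exists_isProfile (hH : Continuous H) (hN : 0 < N) (hd : 0 < d) (hHd : HasDerivAt H d N)
    (hlt : ∀ r, 0 ≤ r → r < N → H r < H N) : ∃ m u, IsProfile H N m u := by
  have hQc : Continuous (dslope H N) := by
    rw [← continuousOn_univ, continuousOn_dslope univ_mem]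
    exact ⟨hH.continuousOn, hHd.differentiableAt⟩
  have hQeq : ∀ w, H N - H w = (N - w) * dslope H N w := by
    intro w
    have := sub_smul_dslope H N w
    rw [smul_eq_mul] at this
    linarith
  have hQpos : ∀ w ∈ Icc 0 N, 0 < dslope H N w := by
    rintro w ⟨h0, h1⟩
    rcases h1.eq_or_lt with rfl | h1
    · rwa [dslope_same, hHd.deriv]
    · have := hlt w h0 h1
      have h2 := hQeq w
      by_contra! h3
      nlinarith [mul_nonpos_of_nonneg_of_nonpos (sub_nonneg.2 h1.le) h3]
  set s : ℝ → ℝ := fun y => N / Real.cosh y ^ 2 with hs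
  have hcosh : ∀ y, 1 ≤ Real.cosh y ^ 2 := fun y => one_le_pow₀ (Real.one_le_cosh y)
  have hsc : Continuous s := continuous_const.div (by fun_prop) fun y => by
    have := hcosh y; positivity
  have hsm : ∀ y, s y ∈ Icc 0 N := fun y =>
    ⟨by positivity, div_le_self hN.le (hcosh y)⟩
  set g : ℝ → ℝ := fun y => √(N * dslope H N (s y)) with hg
  have hgc : Continuous g := by fun_prop
  have hgsq : ∀ y, g y ^ 2 = N * dslope H N (s y) := fun y =>
    Real.sq_sqrt (mul_pos hN (hQpos _ (hsm y))).le
  have hgpos : ∀ y, 0 < g y := fun y => Real.sqrt_pos.2 (mul_pos hN (hQpos _ (hsm y)))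
  have hne : (Icc (0 : ℝ) N).Nonempty := ⟨0, le_rfl, hN.le⟩
  have hcont : ContinuousOn (fun w => √(N * dslope H N w)) (Icc 0 N) := by fun_prop
  obtain ⟨w₁, hw₁, hmin⟩ := isCompact_Icc.exists_isMinOn hne hcont
  obtain ⟨w₂, hw₂, hmax⟩ := isCompact_Icc.exists_isMaxOn hne hcont
  set c := √(N * dslope H N w₁) with hc
  set C := √(N * dslope H N w₂) with hC
  have hcpos : 0 < c := Real.sqrt_pos.2 (mul_pos hN (hQpos _ hw₁))
  have hcg : ∀ y, c ≤ g y := fun y => hmin (hsm y)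
  have hgC : ∀ y, g y ≤ C := fun y => hmax (hsm y)
  obtain ⟨Y, hYd, hYodd⟩ := exists_odd_flow hgc (fun y => by simp [hg, hs]) hgpos hgC
  have hY0 : Y 0 = 0 := by have := hYodd 0; simp at this; linarith
  have hYmono : StrictMono Y := strictMono_of_deriv_pos fun x => by
    rw [(hYd x).deriv]; exact hgpos _
  have hYc : Continuous Y := continuous_iff_continuousAt.2 fun x => (hYd x).continuousAt
  set u : ℝ → ℝ := fun x => √N / Real.cosh (Y x) with hu
  have husq : ∀ x, u x ^ 2 = s (Y x) := fun x => by
    simp only [hu, hs, div_pow, Real.sq_sqrt hN.le]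
  have hud : ∀ x, HasDerivAt u (-u x * (Real.sinh (Y x) / Real.cosh (Y x)) * g (Y x)) x := by
    intro x
    have h := ((Real.hasDerivAt_cosh (Y x)).comp x (hYd x)).inv (Real.cosh_pos _).ne'
    have hcx := (Real.cosh_pos (Y x)).ne'
    refine (h.const_mul (√N)).congr_deriv ?_
    simp only [hu, Function.comp]
    field_simp
  have hdsq : ∀ x, deriv u x ^ 2 = u x ^ 2 * (H N - H (u x ^ 2)) := by
    intro x
    have hcx := (Real.cosh_pos (Y x)).ne'
    rw [(hud x).deriv, mul_pow, mul_pow, hgsq, husq, hQeq, neg_sq, husq, div_pow, Real.sinh_sq]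
    have : N - s (Y x) = (Real.cosh (Y x) ^ 2 - 1) / Real.cosh (Y x) ^ 2 * N := by
      simp only [hs]; field_simp
    rw [this]; ring
  have hueven : ∀ x, u (-x) = u x := fun x => by simp [hu, hYodd]
  have hTd : ∀ x, HasDerivAt (fun x => Real.sinh (Y x) / Real.cosh (Y x))
      (1 / Real.cosh (Y x) ^ 2 * g (Y x)) x := fun x =>
    HasDerivAt.comp (h₂ := fun y => Real.sinh y / Real.cosh y) x
      (hasDerivAt_sinh_div_cosh (Y x)) (hYd x)
  have hTpos : ∀ x, 0 ≤ 1 / Real.cosh (Y x) ^ 2 * g (Y x) := fun x =>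
    mul_nonneg (by positivity) (hgpos _).le
  have hTmono : Monotone fun x => Real.sinh (Y x) / Real.cosh (Y x) :=
    monotone_of_deriv_nonneg (fun x => (hTd x).differentiableAt) fun x => by
      rw [(hTd x).deriv]; exact hTpos x
  have hTint : IntegrableOn (fun x => 1 / Real.cosh (Y x) ^ 2 * g (Y x)) (Ioi 0) := by
    refine integrableOn_Ioi_deriv_of_nonneg' (fun x _ => hTd x) (fun x _ => hTpos x)
      (tendsto_atTop_ciSup hTmono ⟨1, ?_⟩)
    rintro _ ⟨x, rfl⟩
    exact (div_le_one (Real.cosh_pos _)).2 (Real.sinh_lt_cosh _).le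
  have hudiff : Differentiable ℝ u := fun x => (hud x).differentiableAt
  have hu2 : Integrable fun x => u x ^ 2 := by
    refine integrable_of_even (fun x => by rw [hueven]) ?_
    refine (hTint.const_mul (N / c)).mono' (hudiff.continuous.pow 2).aestronglyMeasurable
      (ae_of_all _ fun x => ?_)
    rw [Real.norm_eq_abs, abs_of_nonneg (sq_nonneg _), husq]
    have h1 := hcg (Y x)
    have h2 := Real.cosh_pos (Y x)
    calc s (Y x) = N / c * (1 / Real.cosh (Y x) ^ 2 * c) := by simp only [hs]; field_simp
      _ ≤ _ := by gcongr
  have hu'2 : Integrable fun x => deriv u x ^ 2 := by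
    obtain ⟨B, hB⟩ := (isCompact_Icc (a := 0) (b := N)).exists_bound_of_continuousOn
      (by fun_prop : Continuous fun r => H N - H r).continuousOn
    simp_rw [hdsq]
    have huc := hudiff.continuous
    refine hu2.mul_bdd (c := B) (by fun_prop : Continuous fun x =>
      H N - H (u x ^ 2)).aestronglyMeasurable (ae_of_all _ fun x => hB _ ?_)
    rw [husq]; exact hsm _
  refine ⟨_, u, ⟨hudiff, hu2, hu'2, rfl⟩, hueven, fun x => ?_, ?_, fun x hx => ?_, fun x hx => ?_,
    hdsq⟩
  · have := Real.cosh_pos (Y x)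
    have := Real.sqrt_pos.2 hN
    positivity
  · simp [husq, hs, hY0]
  · rw [husq]
    have h1 : 0 < Y x := hY0 ▸ hYmono hx
    exact div_lt_self hN (one_lt_pow₀ (Real.one_lt_cosh.2 h1.ne') two_ne_zero)
  · rw [(hud x).deriv]
    have h1 : 0 ≤ Y x := hY0 ▸ hYmono.monotone hx
    have h2 := Real.sinh_nonneg_iff.2 h1
    have h3 := Real.cosh_pos (Y x)
    have h4 := hgpos (Y x)
    have h5 : 0 ≤ u x * (Real.sinh (Y x) / Real.cosh (Y x)) * g (Y x) := by
      simp only [hu]; positivity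
    linarith

end Soliton

section Stationarity

variable {H u : ℝ → ℝ} {N m μ d ρ a : ℝ}

/-- The energy of a profile of maximum `√N`, provided that its mass is `μ`. -/
noncomputable def profileLevel (H : ℝ → ℝ) (μ N : ℝ) : ℝ := calib H (H N) N - H N * μ / 2

lemma calib_mono (hH : Continuous H) (l : ℝ) : Monotone (calib H l) :=
  monotone_of_deriv_nonneg (fun N => (hasDerivAt_calib hH l N).differentiableAt) fun N => by
    rw [(hasDerivAt_calib hH l N).deriv]; positivity

lemma integral_eq_two_mul_of_even {f : ℝ → ℝ} (hf : ∀ x, f (-x) = f x) :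
    ∫ x, f x = 2 * ∫ x in Ioi 0, f x := by
  rw [← integral_comp_abs]
  congr 1; ext x
  rcases abs_choice x with h | h <;> rw [h]
  rw [hf]

lemma actionDensity_add (l k x : ℝ) :
    actionDensity H (l + k) u x = actionDensity H l u x + k * u x ^ 2 := by
  rw [actionDensity, actionDensity]; ring

namespace IsProfile

variable (hu : IsProfile H N m u)
include hu

lemma mass_pos : 0 < m := by
  have h := hu.inH1mass
  rw [← h.2.2.2, integral_pos_iff_support_of_nonneg (fun x => sq_nonneg _) h.2.1]
  exact (h.1.continuous.pow 2).isOpen_support.measure_pos _ ⟨0, (pow_pos (hu.pos 0) 2).ne'⟩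

lemma antitoneOn_sq : AntitoneOn (fun x => u x ^ 2) (Ici 0) := by
  have hd := fun x => hu.inH1mass.hasDerivAt_sq x
  refine antitoneOn_of_deriv_nonpos (convex_Ici 0)
    (fun x _ => (hd x).continuousAt.continuousWithinAt)
    (fun x _ => (hd x).differentiableAt.differentiableWithinAt) fun x hx => ?_
  rw [(hd x).deriv]
  rw [interior_Ici] at hx
  exact mul_nonpos_of_nonneg_of_nonpos (by have := hu.pos x; positivity)
    (hu.deriv_nonpos x (le_of_lt hx))

lemma sq_le (x : ℝ) : u x ^ 2 ≤ N := by
  have key : ∀ y, 0 ≤ y → u y ^ 2 ≤ N := fun y hy => by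
    rw [← hu.sq_zero]; exact hu.antitoneOn_sq self_mem_Ici hy hy
  rcases le_total 0 x with h | h
  · exact key x h
  · rw [← hu.even]; exact key _ (neg_nonneg.2 h)

lemma setIntegral_actionDensity (hH : Continuous H) (ha : 0 ≤ a) :
    ∫ x in Ioi a, actionDensity H (H N) u x = calib H (H N) (u a ^ 2) := by
  have hE : ∀ x ∈ Ioi a, actionDensity H (H N) u x =
      -(√(H N - H (u x ^ 2)) * (2 * u x * deriv u x)) := by
    intro x hx
    have h1 := hu.pos x
    have h2 : √(H N - H (u x ^ 2)) * u x = -deriv u x := by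
      have e : H N - H (u x ^ 2) = (-deriv u x / u x) ^ 2 := by
        rw [div_pow, neg_sq, hu.deriv_sq]; field_simp
      rw [e, Real.sqrt_sq (div_nonneg (neg_nonneg.2 (hu.deriv_nonpos x (ha.trans (le_of_lt hx))))
        h1.le), div_mul_cancel₀ _ h1.ne']
    rw [actionDensity, ← hu.deriv_sq]
    linear_combination 2 * deriv u x * h2
  have hA := (hu.inH1mass.integrable_actionDensity hu.mass_pos hH (H N)).integrableOn (s := Ioi a)
  rw [setIntegral_congr_fun measurableSet_Ioi hE, integral_neg,
    integral_actionDensity_of_calib hH hu.inH1mass, neg_neg]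
  exact (hA.congr_fun hE measurableSet_Ioi).neg.congr_fun (fun x _ => by simp) measurableSet_Ioi

lemma integral_actionDensity (hH : Continuous H) :
    ∫ x, actionDensity H (H N) u x = 2 * calib H (H N) N := by
  rw [integral_eq_two_mul_of_even, hu.setIntegral_actionDensity hH le_rfl, hu.sq_zero]
  intro x
  rw [← actionDensity_comp_neg]
  simp_rw [hu.even]

lemma calib_sub_le (hH : Continuous H) {N' : ℝ} (hle : ∀ r ∈ Icc 0 N, H r ≤ H N') :
    2 * calib H (H N') N ≤ 2 * calib H (H N) N + (H N' - H N) * m := by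
  have h1 := two_mul_calib_le (x₀ := 0) hu.mass_pos hH hu.inH1mass
    fun x => hle _ ⟨sq_nonneg _, hu.sq_le x⟩
  rw [hu.sq_zero] at h1
  have hA := hu.inH1mass.integrable_actionDensity hu.mass_pos hH (H N)
  have e : ∫ x, actionDensity H (H N') u x =
      2 * calib H (H N) N + (H N' - H N) * m := by
    have : ∀ x, actionDensity H (H N') u x =
        actionDensity H (H N) u x + (H N' - H N) * u x ^ 2 := fun x => by
      rw [← actionDensity_add]; congr 1; ring
    simp_rw [this]
    rw [integral_add hA (hu.inH1mass.2.1.const_mul _), integral_const_mul, hu.inH1mass.2.2.2,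
      hu.integral_actionDensity hH]
  linarith

lemma le_mass (hH : Continuous H) (hd : 0 < d) (hHd : HasDerivAt H d N) (hN : 0 ≤ N)
    (hmono : ∀ N', N ≤ N' → ∀ r ∈ Icc 0 N', H r ≤ H N')
    (hmin : ∀ᶠ N' in 𝓝[>] N, profileLevel H μ N ≤ profileLevel H μ N') : μ ≤ m := by
  by_contra! hlt
  have hδ : 0 < μ - m := sub_pos.2 hlt
  have key : ∀ᶠ N' in 𝓝[>] N, slope H N N' * ((μ - m) ^ 2 / 4) ≤ N' - N := by
    filter_upwards [hmin, self_mem_nhdsWithin] with N' h1 (h2 : N < N')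
    have hΔ : 0 ≤ H N' - H N := sub_nonneg.2 (hmono N' h2.le N ⟨hN, h2.le⟩)
    have h3 := hu.calib_sub_le hH (N' := N') fun r hr => hmono N' h2.le r ⟨hr.1, hr.2.trans h2.le⟩
    have hc : Continuous fun r => √(H N' - H r) := by fun_prop
    have h4 : calib H (H N') N' - calib H (H N') N ≤ (N' - N) * √(H N' - H N) := by
      rw [calib, calib, intervalIntegral.integral_interval_sub_left (hc.intervalIntegrable _ _)
        (hc.intervalIntegrable _ _)]
      have := intervalIntegral.integral_mono_on (μ := volume) (g := fun _ => √(H N' - H N)) h2.le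
        (hc.intervalIntegrable N N') (continuous_const.intervalIntegrable N N') fun r hr =>
          Real.sqrt_le_sqrt (sub_le_sub_left (hmono r hr.1 N ⟨hN, hr.1⟩) _)
      simpa using this
    rw [profileLevel, profileLevel] at h1
    have hs := Real.sq_sqrt hΔ
    have hs0 := Real.sqrt_nonneg (H N' - H N)
    have h5 : √(H N' - H N) ^ 2 * (μ - m) ≤ 2 * ((N' - N) * √(H N' - H N)) := by
      rw [hs]; linarith
    have h6 : √(H N' - H N) * ((μ - m) / 2) ≤ N' - N := by
      rcases hs0.eq_or_lt with h0 | h0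
      · rw [← h0]; linarith
      · by_contra! h7
        nlinarith
    have h7 : (H N' - H N) * ((μ - m) ^ 2 / 4) ≤ (N' - N) ^ 2 := by
      calc _ = (√(H N' - H N) * ((μ - m) / 2)) ^ 2 := by rw [mul_pow, hs]; ring
        _ ≤ _ := by gcongr
    have h8 : 0 < N' - N := sub_pos.2 h2
    rw [slope_def_field, div_mul_eq_mul_div, div_le_iff₀ h8]
    linarith
  have hs : Tendsto (slope H N) (𝓝[>] N) (𝓝 d) :=
    hHd.tendsto_slope.mono_left (nhdsWithin_mono _ fun x hx => ne_of_gt hx)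
  have ht : Tendsto (fun N' => N' - N) (𝓝[>] N) (𝓝 0) := by
    have : Tendsto (fun N' => N' - N) (𝓝 N) (𝓝 (N - N)) := tendsto_id.sub_const N
    rw [sub_self] at this
    exact this.mono_left nhdsWithin_le_nhds
  have := le_of_tendsto_of_tendsto (hs.mul_const _) ht key
  have : 0 < d * ((μ - m) ^ 2 / 4) := by positivity
  linarith

lemma mass_le (hH : Continuous H) (hlt : ∀ r, 0 ≤ r → r < N → H r < H N)
    (hmono : ∀ᶠ N' in 𝓝[<] N, ∀ r ∈ Icc 0 N', H r ≤ H N')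
    (hmin : ∀ᶠ N' in 𝓝[<] N, profileLevel H μ N ≤ profileLevel H μ N') : m ≤ μ := by
  have hv := hu.inH1mass
  have hta : Tendsto (fun a => u a ^ 2) (𝓝[>] 0) (𝓝[<] N) := by
    refine tendsto_nhdsWithin_iff.2 ⟨?_, eventually_mem_nhdsWithin.mono fun a ha => hu.sq_lt a ha⟩
    have : Tendsto (fun a => u a ^ 2) (𝓝 0) (𝓝 (u 0 ^ 2)) :=
      (hv.1.continuous.pow 2).tendsto 0
    rw [hu.sq_zero] at this
    exact this.mono_left nhdsWithin_le_nhds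
  have key : ∀ᶠ a in 𝓝[>] (0 : ℝ), m ≤ μ + 2 * (a * N) := by
    filter_upwards [hta.eventually hmono, hta.eventually hmin, self_mem_nhdsWithin]
      with a h1 h2 (h3 : 0 < a)
    have hΔ : 0 < H N - H (u a ^ 2) := sub_pos.2 (hlt _ (sq_nonneg _) (hu.sq_lt a h3))
    have h4 := calib_le_setIntegral_Ioi (x₀ := a) (l := H (u a ^ 2)) hu.mass_pos hH hv
      fun x hx => h1 _ ⟨sq_nonneg _, hu.antitoneOn_sq (mem_Ici.2 h3.le)
        (mem_Ici.2 (h3.le.trans (le_of_lt hx))) (le_of_lt hx)⟩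
    have hA := (hv.integrable_actionDensity hu.mass_pos hH (H N)).integrableOn (s := Ioi a)
    have hu2 := hv.2.1.integrableOn (s := Ioi a)
    have e : ∫ x in Ioi a, actionDensity H (H (u a ^ 2)) u x =
        calib H (H N) (u a ^ 2) - (H N - H (u a ^ 2)) * ∫ x in Ioi a, u x ^ 2 := by
      have : ∀ x, actionDensity H (H (u a ^ 2)) u x =
          actionDensity H (H N) u x - (H N - H (u a ^ 2)) * u x ^ 2 := fun x => by
        rw [actionDensity, actionDensity]; ring
      simp_rw [this]
      rw [integral_sub hA (hu2.const_mul _), integral_const_mul,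
        hu.setIntegral_actionDensity hH h3.le]
    have h5 := calib_mono hH (H N) (hu.sq_lt a h3).le
    rw [profileLevel, profileLevel] at h2
    have h6 : ∫ x in Ioi a, u x ^ 2 ≤ μ / 2 := by
      by_contra! h7
      nlinarith
    have h7 : m = 2 * ∫ x in Ioi 0, u x ^ 2 := by
      rw [← hv.2.2.2]; exact integral_eq_two_mul_of_even fun x => by rw [hu.even]
    have h8 := intervalIntegral.integral_interval_add_Ioi (a := 0) (b := a)
      hv.2.1.integrableOn hu2
    have h9 := intervalIntegral.integral_mono_on h3.le
      ((hv.1.continuous.pow 2).intervalIntegrable (μ := volume) 0 a)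
      (continuous_const (y := N).intervalIntegrable (μ := volume) 0 a) fun x _ => hu.sq_le x
    simp only [intervalIntegral.integral_const, smul_eq_mul, sub_zero, Pi.pow_apply] at h9
    linarith
  have ht : Tendsto (fun a : ℝ => μ + 2 * (a * N)) (𝓝[>] 0) (𝓝 μ) := by
    have : Tendsto (fun a : ℝ => μ + 2 * (a * N)) (𝓝 0) (𝓝 (μ + 2 * (0 * N))) :=
      (by fun_prop : Continuous fun a : ℝ => μ + 2 * (a * N)).tendsto 0
    simp only [zero_mul, mul_zero, add_zero] at this
    exact this.mono_left nhdsWithin_le_nhds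
  exact ge_of_tendsto ht key

end IsProfile

end Stationarity

section Level

variable {p q α μ N : ℝ} {v w : ℝ → ℝ}

lemma continuous_profileLevel_nlsPot (hq : 2 < q) (hqp : q < p) (μ : ℝ) :
    Continuous fun z : ℝ × ℝ => profileLevel (nlsPot p q z.1) μ z.2 := by
  have hH := continuous_nlsPot_uncurry hq hqp
  have h1 : Continuous fun z : ℝ × ℝ => calib (nlsPot p q z.1) (nlsPot p q z.1 z.2) z.2 := by
    refine intervalIntegral.continuous_parametric_intervalIntegral_of_continuous
      (f := fun (z : ℝ × ℝ) r => √(nlsPot p q z.1 z.2 - nlsPot p q z.1 r)) ?_ continuous_snd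
    exact ((hH.comp continuous_fst).sub (hH.comp
      ((continuous_fst.comp continuous_fst).prodMk continuous_snd))).sqrt
  exact h1.sub ((hH.mul_const μ).div_const 2)

lemma energy_nonneg_of_nlsPot_nonpos (hq : 2 < q) (hqp : q < p) (hμ : 0 < μ)
    (hv : InH1mass μ v) {x₀ : ℝ} (h₀ : v x₀ ≠ 0) (hmax : ∀ x, v x ^ 2 ≤ v x₀ ^ 2)
    (hneg : nlsPot p q α (v x₀ ^ 2) ≤ 0) : 0 ≤ NLSenergy p q α v := by
  have h := integral_actionDensity_nlsPot hμ hv hq hqp α 0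
  have : 0 ≤ ∫ x, actionDensity (nlsPot p q α) 0 v x := integral_nonneg fun x => by
    have := nlsPot_nonpos hq hqp (by positivity) (sq_nonneg (v x)) (hmax x) hneg
    exact add_nonneg (sq_nonneg _) (mul_nonneg (sq_nonneg _) (by linarith))
  linarith

lemma profileLevel_le_energy (hq : 2 < q) (hqp : q < p) (hμ : 0 < μ)
    (hv : InH1mass μ v) {x₀ : ℝ} (h₀ : v x₀ ≠ 0) (hmax : ∀ x, v x ^ 2 ≤ v x₀ ^ 2)
    (hpos : 0 ≤ nlsPot p q α (v x₀ ^ 2)) :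
    profileLevel (nlsPot p q α) μ (v x₀ ^ 2) ≤ NLSenergy p q α v := by
  have h := integral_actionDensity_nlsPot hμ hv hq hqp α (nlsPot p q α (v x₀ ^ 2))
  have := two_mul_calib_le (x₀ := x₀) hμ (continuous_nlsPot hq hqp α) hv fun x =>
    nlsPot_le hq hqp (by positivity) (sq_nonneg (v x)) (hmax x) hpos
  rw [profileLevel]
  linarith

lemma IsProfile.energy_eq (hq : 2 < q) (hqp : q < p) (hv : IsProfile (nlsPot p q α) N μ v) :
    NLSenergy p q α v = profileLevel (nlsPot p q α) μ N := by
  have h := integral_actionDensity_nlsPot hv.mass_pos hv.inH1mass hq hqp α (nlsPot p q α N)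
  rw [hv.integral_actionDensity (continuous_nlsPot hq hqp α)] at h
  rw [profileLevel]
  linarith

lemma profileLevel_pos_of_nlsExcess_eq_zero (hq : 2 < q) (hqp : q < p) (hN : 0 < N)
    (h0 : nlsExcess p q α N = 0) : 0 < profileLevel (nlsPot p q α) μ N := by
  have hHN : nlsPot p q α N = 0 := by rw [nlsPot_eq hN, h0, mul_zero]
  have hH := continuous_nlsPot hq hqp α
  rw [profileLevel, calib, hHN, zero_mul, zero_div, sub_zero]
  refine intervalIntegral.intervalIntegral_pos_of_pos_on
    ((by fun_prop : Continuous fun r => √(0 - nlsPot p q α r)).intervalIntegrable _ _)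
    (fun r hr => Real.sqrt_pos.2 ?_) hN
  rw [nlsPot_eq hr.1]
  have h1 := nlsExcess_strictMono (α := α) hq hqp hr.1.le hr.2
  rw [h0] at h1
  have h2 := Real.rpow_pos_of_pos hr.1 ((q - 2) / 2)
  nlinarith

lemma pos_of_nlsExcess_nonneg (hq : 2 < q) (hqp : q < p) (hα : α < 0) (hN : 0 ≤ N)
    (h : 0 ≤ nlsExcess p q α N) : 0 < N := by
  refine hN.lt_of_ne fun h0 => ?_
  rw [← h0, nlsExcess, Real.zero_rpow (by linarith), mul_zero, zero_add] at h
  have : 2 * α / q < 0 := div_neg_of_neg_of_pos (by linarith) (by linarith)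
  linarith

lemma exists_forall_profileLevel_pos (hq : 2 < q) (hqp : q < p) (hp : p < 6) (μ : ℝ) :
    ∃ R, 0 < R ∧ ∀ α ≤ 0, ∀ N, R ≤ N → 0 ≤ nlsExcess p q α N →
      0 < profileLevel (nlsPot p q α) μ N := by
  set c : ℝ := 1 - (1 / 2) ^ ((q - 2) / 2) with hc
  have hcpos : 0 < c := sub_pos.2 (Real.rpow_lt_one (by norm_num) (by norm_num) (by linarith))
  have hsc : 0 < √c := Real.sqrt_pos.2 hcpos
  have ht : Tendsto (fun N : ℝ => N ^ ((6 - p) / 4) * √c) atTop atTop :=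
    (tendsto_rpow_atTop (by linarith)).atTop_mul_const hsc
  obtain ⟨R, hR⟩ := eventually_atTop.1 (ht.eventually_gt_atTop (√(2 / p) * |μ|))
  refine ⟨max R 1, by positivity, fun α hα N hN hex => ?_⟩
  have hNpos : 0 < N := one_pos.trans_le ((le_max_right _ _).trans hN)
  rcases hex.eq_or_lt with h0 | hex
  · exact profileLevel_pos_of_nlsExcess_eq_zero hq hqp hNpos h0.symm
  have hH := continuous_nlsPot hq hqp α
  set h := nlsPot p q α N with hh
  have hpos : 0 < h := by rw [hh, nlsPot_eq hNpos]; positivity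
  have hshpos : 0 < √h := Real.sqrt_pos.2 hpos
  have hcal : N / 2 * (√c * √h) ≤ calib (nlsPot p q α) h N := by
    refine le_trans ?_ (calib_mono hH h (half_le_self hNpos.le))
    have := intervalIntegral.integral_mono_on (μ := volume) (a := 0) (b := N / 2)
      (f := fun _ => √c * √h) (g := fun r => √(h - nlsPot p q α r)) (by positivity)
      (continuous_const.intervalIntegrable _ _)
      ((by fun_prop : Continuous fun r => √(h - nlsPot p q α r)).intervalIntegrable _ _)
      fun r hr => by
        rw [← Real.sqrt_mul hcpos.le]
        refine Real.sqrt_le_sqrt ?_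
        have h1 := nlsPot_le_rpow_mul (α := α) hq hqp hNpos hr.1 (by linarith [hr.2])
        have h2 : (r / N) ^ ((q - 2) / 2) ≤ (1 / 2) ^ ((q - 2) / 2) :=
          Real.rpow_le_rpow (div_nonneg hr.1 hNpos.le)
            ((div_le_iff₀ hNpos).2 (by linarith [hr.2])) (by linarith)
        rw [hc]
        nlinarith
    rwa [intervalIntegral.integral_const, smul_eq_mul, sub_zero] at this
  have hupper : √h ≤ √(2 / p) * N ^ ((p - 2) / 4) := by
    have e : √(2 / p) * N ^ ((p - 2) / 4) = √(2 / p * N ^ ((p - 2) / 2)) := by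
      rw [Real.sqrt_mul (by have : 0 < p := by linarith
                            positivity), Real.sqrt_eq_rpow (N ^ _), ← Real.rpow_mul hNpos.le]
      congr 2; ring
    rw [e]
    refine Real.sqrt_le_sqrt ?_
    rw [hh, nlsPot]
    have : 2 * α / q * N ^ ((q - 2) / 2) ≤ 0 := mul_nonpos_of_nonpos_of_nonneg
      (div_nonpos_of_nonpos_of_nonneg (by linarith) (by linarith)) (by positivity)
    linarith
  have hNe : N ^ ((p - 2) / 4) * N ^ ((6 - p) / 4) = N := by
    rw [← Real.rpow_add hNpos, (by ring : (p - 2) / 4 + (6 - p) / 4 = 1), Real.rpow_one]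
  have hRN := hR N ((le_max_left _ _).trans hN)
  have hfin : √h * μ < N * √c := by
    calc √h * μ ≤ √h * |μ| := by gcongr; exact le_abs_self μ
      _ ≤ √(2 / p) * N ^ ((p - 2) / 4) * |μ| := by gcongr
      _ = N ^ ((p - 2) / 4) * (√(2 / p) * |μ|) := by ring
      _ < N ^ ((p - 2) / 4) * (N ^ ((6 - p) / 4) * √c) := by gcongr
      _ = N * √c := by rw [← mul_assoc, hNe]
  have hsq := Real.sq_sqrt hpos.le
  have e : h * μ = √h * (√h * μ) := by rw [← mul_assoc, ← sq, hsq]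
  rw [profileLevel, ← hh, e]
  nlinarith [mul_lt_mul_of_pos_left hfin hshpos]

lemma exists_profileLevel_of_energy_neg (hq : 2 < q) (hqp : q < p) (hμ : 0 < μ)
    (hv : InH1mass μ v) (hE : NLSenergy p q α v < 0) :
    ∃ N, 0 ≤ N ∧ 0 ≤ nlsExcess p q α N ∧ profileLevel (nlsPot p q α) μ N < 0 := by
  obtain ⟨x₀, h₀, hmax⟩ := hv.exists_max hμ
  have hN : 0 < v x₀ ^ 2 := by positivity
  rcases le_or_gt (nlsPot p q α (v x₀ ^ 2)) 0 with h | h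
  · exact absurd hE (energy_nonneg_of_nlsPot_nonpos hq hqp hμ hv h₀ hmax h).not_gt
  · refine ⟨_, hN.le, ?_, (profileLevel_le_energy hq hqp hμ hv h₀ hmax h.le).trans_lt hE⟩
    rw [nlsPot_eq hN] at h
    exact (pos_of_mul_pos_right h (by positivity)).le

lemma exists_minimizer (hq : 2 < q) (hqp : q < p) (hp : p < 6) (hμ : 0 < μ) (hα : α < 0)
    (hN : 0 ≤ N) (hex : 0 ≤ nlsExcess p q α N) (hle : profileLevel (nlsPot p q α) μ N ≤ 0) :
    ∃ u, InH1mass μ u ∧ NLSenergy p q α u ≤ 0 ∧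
      ∀ v, InH1mass μ v → NLSenergy p q α u ≤ NLSenergy p q α v := by
  obtain ⟨R, hR, hRpos⟩ := exists_forall_profileLevel_pos hq hqp hp μ
  have hlt : ∀ {N}, 0 ≤ nlsExcess p q α N → profileLevel (nlsPot p q α) μ N ≤ 0 → N < R :=
    fun h1 h2 => lt_of_not_ge fun h3 => (hRpos α hα.le _ h3 h1).not_ge h2
  have hG : Continuous (nlsExcess p q α) :=
    (continuous_nlsExcess_uncurry hqp).comp (by fun_prop : Continuous fun r : ℝ => (α, r))
  have hH := continuous_nlsPot hq hqp α
  have hL : Continuous (profileLevel (nlsPot p q α) μ) :=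
    (continuous_profileLevel_nlsPot hq hqp μ).comp (by fun_prop : Continuous fun r : ℝ => (α, r))
  have hK : IsCompact (Icc 0 R ∩ {N | 0 ≤ nlsExcess p q α N}) :=
    isCompact_Icc.inter_right (isClosed_le continuous_const hG)
  obtain ⟨N₀, ⟨hN₀, hex₀⟩, hmin⟩ := hK.exists_isMinOn
    ⟨N, ⟨hN, (hlt hex hle).le⟩, hex⟩ hL.continuousOn
  have hle₀ : profileLevel (nlsPot p q α) μ N₀ ≤ 0 :=
    (hmin ⟨⟨hN, (hlt hex hle).le⟩, hex⟩).trans hle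
  have hN₀pos := pos_of_nlsExcess_nonneg hq hqp hα hN₀.1 hex₀
  have hex₀' : 0 < nlsExcess p q α N₀ := lt_of_le_of_ne hex₀ fun h =>
    (profileLevel_pos_of_nlsExcess_eq_zero hq hqp hN₀pos h.symm).not_ge hle₀
  have hpot : 0 < nlsPot p q α N₀ := by rw [nlsPot_eq hN₀pos]; positivity
  have hnear : ∀ᶠ N' in 𝓝 N₀, 0 < N' ∧ N' ≤ R ∧ 0 ≤ nlsExcess p q α N' := by
    filter_upwards [lt_mem_nhds hN₀pos, gt_mem_nhds (hlt hex₀ hle₀),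
      hG.continuousAt.eventually_const_lt hex₀'] with N' h1 h2 h3 using ⟨h1, h2.le, h3.le⟩
  have hminnear : ∀ᶠ N' in 𝓝 N₀,
      profileLevel (nlsPot p q α) μ N₀ ≤ profileLevel (nlsPot p q α) μ N' :=
    hnear.mono fun N' h => hmin ⟨⟨h.1.le, h.2.1⟩, h.2.2⟩
  have hmono : ∀ N', 0 < N' → 0 ≤ nlsExcess p q α N' →
      ∀ r ∈ Icc 0 N', nlsPot p q α r ≤ nlsPot p q α N' := fun N' h1 h2 r hr =>
    nlsPot_le hq hqp h1 hr.1 hr.2 (by rw [nlsPot_eq h1]; positivity)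
  have hltpot : ∀ r, 0 ≤ r → r < N₀ → nlsPot p q α r < nlsPot p q α N₀ := fun r h1 h2 =>
    nlsPot_lt hq hqp hN₀pos h1 h2 hpot
  obtain ⟨d, hd, hHd⟩ := exists_hasDerivAt_nlsPot hq hqp hN₀pos hpot
  obtain ⟨m, u, hu⟩ := exists_isProfile hH hN₀pos hd hHd hltpot
  obtain rfl : m = μ := le_antisymm
    (hu.mass_le hH hltpot (nhdsWithin_le_nhds (hnear.mono fun N' h => hmono N' h.1 h.2.2))
      (nhdsWithin_le_nhds hminnear))
    (hu.le_mass hH hd hHd hN₀pos.le (fun N' h => hmono N' (hN₀pos.trans_le h)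
      (hex₀.trans (nlsExcess_mono hq hqp hN₀pos.le h))) (nhdsWithin_le_nhds hminnear))
  have hE := hu.energy_eq hq hqp
  refine ⟨u, hu.inH1mass, hE.trans_le hle₀, fun v hv => ?_⟩
  obtain ⟨x₀, h₀, hmax⟩ := hv.exists_max hμ
  have hNv : 0 < v x₀ ^ 2 := by positivity
  rcases le_or_gt (nlsPot p q α (v x₀ ^ 2)) 0 with h | h
  · linarith [energy_nonneg_of_nlsPot_nonpos hq hqp hμ hv h₀ hmax h]
  · refine hE.trans_le (le_trans ?_ (profileLevel_le_energy hq hqp hμ hv h₀ hmax h.le))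
    rw [nlsPot_eq hNv] at h
    have hexv := (pos_of_mul_pos_right h (by positivity)).le
    rcases le_or_gt (v x₀ ^ 2) R with h1 | h1
    · exact hmin ⟨⟨hNv.le, h1⟩, hexv⟩
    · exact hle₀.trans (hRpos α hα.le _ h1.le hexv).le

end Level

section Scaling

variable {p q α μ ε : ℝ} {v w : ℝ → ℝ}

lemma exists_inH1mass (hμ : 0 < μ) : ∃ w, InH1mass μ w := by
  set c := √(μ / √Real.pi)
  have hc : c ^ 2 = μ / √Real.pi := Real.sq_sqrt (by positivity)
  have hexp : ∀ x : ℝ, Real.exp (-(1 / 2) * x ^ 2) ^ 2 = Real.exp (-1 * x ^ 2) := fun x => by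
    rw [← Real.exp_nat_mul]; congr 1; push_cast; ring
  have hd : ∀ x, HasDerivAt (fun x => c * Real.exp (-(1 / 2) * x ^ 2))
      (c * (Real.exp (-(1 / 2) * x ^ 2) * -x)) x := fun x => by
    have h := (((hasDerivAt_pow 2 x).const_mul (-(1 / 2) : ℝ)).exp).const_mul c
    refine h.congr_deriv ?_
    push_cast; ring
  refine ⟨fun x => c * Real.exp (-(1 / 2) * x ^ 2), fun x => (hd x).differentiableAt, ?_, ?_, ?_⟩
  · simp_rw [mul_pow, hexp]
    exact (integrable_exp_neg_mul_sq one_pos).const_mul _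
  · simp_rw [fun x => (hd x).deriv, mul_pow, hexp, neg_sq]
    have := integrable_rpow_mul_exp_neg_mul_sq one_pos (s := 2) (by norm_num)
    simp only [Real.rpow_two] at this
    simp_rw [mul_comm (Real.exp _)]
    exact this.const_mul _
  · simp_rw [mul_pow, hexp]
    rw [integral_const_mul, integral_gaussian, hc, div_one]
    exact div_mul_cancel₀ _ (Real.sqrt_pos.2 Real.pi_pos).ne'

/-- The mass-preserving dilation of `w`. -/
noncomputable def dilate (ε : ℝ) (w : ℝ → ℝ) (x : ℝ) : ℝ := √ε * w (ε * x)

lemma hasDerivAt_dilate (hw : InH1mass μ w) (x : ℝ) :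
    HasDerivAt (dilate ε w) (√ε * (deriv w (ε * x) * ε)) x := by
  have h1 : HasDerivAt (fun x : ℝ => ε * x) ε x := by simpa using (hasDerivAt_id x).const_mul ε
  exact (HasDerivAt.comp x (hw.1 (ε * x)).hasDerivAt h1).const_mul _

lemma InH1mass.dilate (hε : 0 < ε) (hw : InH1mass μ w) : InH1mass μ (dilate ε w) := by
  refine ⟨fun x => (hasDerivAt_dilate hw x).differentiableAt, ?_, ?_, ?_⟩
  · simp_rw [_root_.dilate, mul_pow]
    exact (hw.2.1.comp_mul_left' hε.ne').const_mul _
  · simp_rw [fun x => (hasDerivAt_dilate (ε := ε) hw x).deriv, mul_pow]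
    exact ((hw.2.2.1.comp_mul_left' hε.ne').mul_const _).const_mul _
  · simp_rw [_root_.dilate, mul_pow, Real.sq_sqrt hε.le]
    rw [integral_const_mul, Measure.integral_comp_mul_left (fun y => w y ^ 2), hw.2.2.2,
      abs_of_pos (inv_pos.2 hε), smul_eq_mul, mul_inv_cancel_left₀ hε.ne']

lemma integral_abs_dilate_rpow (hε : 0 < ε) (w : ℝ → ℝ) (s : ℝ) :
    ∫ x, |dilate ε w x| ^ s = ε ^ ((s - 2) / 2) * ∫ x, |w x| ^ s := by
  simp_rw [dilate, abs_mul, abs_of_nonneg (Real.sqrt_nonneg ε),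
    Real.mul_rpow (Real.sqrt_nonneg ε) (abs_nonneg _)]
  rw [integral_const_mul, Measure.integral_comp_mul_left (fun y => |w y| ^ s),
    abs_of_pos (inv_pos.2 hε), smul_eq_mul, ← mul_assoc]
  congr 1
  rw [Real.sqrt_eq_rpow, ← Real.rpow_mul hε.le, ← Real.rpow_neg_one, ← Real.rpow_add hε]
  congr 1; ring

lemma energy_dilate (hq : 2 < q) (hqp : q < p) (hμ : 0 < μ) (hw : InH1mass μ w) (hε : 0 < ε)
    (α : ℝ) :
    NLSenergy p q α (dilate ε w) = 1 / 2 * (ε ^ 2 * ∫ x, deriv w x ^ 2)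
      - 1 / p * (ε ^ ((p - 2) / 2) * ∫ x, |w x| ^ p)
      - α / q * (ε ^ ((q - 2) / 2) * ∫ x, |w x| ^ q) := by
  have hd : ∫ x, deriv (dilate ε w) x ^ 2 = ε ^ 2 * ∫ x, deriv w x ^ 2 := by
    simp_rw [fun x => (hasDerivAt_dilate (ε := ε) hw x).deriv, mul_pow, Real.sq_sqrt hε.le]
    rw [integral_const_mul, integral_mul_const,
      Measure.integral_comp_mul_left (fun y => deriv w y ^ 2), abs_of_pos (inv_pos.2 hε),
      smul_eq_mul]
    field_simp
  rw [NLSenergy_eq hμ (hw.dilate hε) hq hqp, hd, integral_abs_dilate_rpow hε,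
    integral_abs_dilate_rpow hε]

lemma exists_energy_lt (hq : 2 < q) (hqp : q < p) (hμ : 0 < μ) (α : ℝ) {δ : ℝ} (hδ : 0 < δ) :
    ∃ v, InH1mass μ v ∧ NLSenergy p q α v < δ := by
  obtain ⟨w, hw⟩ := exists_inH1mass hμ
  have hp2 : 0 < (p - 2) / 2 := by linarith
  have hq2 : 0 < (q - 2) / 2 := by linarith
  have h1 := Real.continuous_rpow_const hp2.le
  have h2 := Real.continuous_rpow_const hq2.le
  have hc : Continuous fun ε : ℝ => 1 / 2 * (ε ^ 2 * ∫ x, deriv w x ^ 2)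
      - 1 / p * (ε ^ ((p - 2) / 2) * ∫ x, |w x| ^ p)
      - α / q * (ε ^ ((q - 2) / 2) * ∫ x, |w x| ^ q) := by fun_prop
  have h := hc.tendsto 0
  simp only [Real.zero_rpow hp2.ne', Real.zero_rpow hq2.ne', zero_mul, mul_zero, sub_zero,
    ne_eq, OfNat.ofNat_ne_zero, not_false_eq_true, zero_pow] at h
  obtain ⟨ε, hlt, hε⟩ := (((h.mono_left nhdsWithin_le_nhds).eventually_lt_const hδ).and
    (self_mem_nhdsWithin (s := Ioi (0 : ℝ)))).exists
  exact ⟨_, hw.dilate hε, by rwa [energy_dilate hq hqp hμ hw hε]⟩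

lemma exists_energy_zero_neg (hq : 2 < q) (hqp : q < p) (hp : p < 6) (hμ : 0 < μ) :
    ∃ v, InH1mass μ v ∧ NLSenergy p q 0 v < 0 := by
  obtain ⟨w, hw⟩ := exists_inH1mass hμ
  have hB := hw.integral_abs_rpow_pos hμ (hq.trans hqp)
  have hp6 : 0 < (6 - p) / 2 := by linarith
  have h1 := Real.continuous_rpow_const hp6.le
  have hc : Continuous fun ε : ℝ => 1 / 2 * (ε ^ ((6 - p) / 2) * ∫ x, deriv w x ^ 2)
      - 1 / p * ∫ x, |w x| ^ p := by fun_prop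
  have h := hc.tendsto 0
  simp only [Real.zero_rpow hp6.ne', zero_mul, mul_zero, zero_sub] at h
  have hneg : -(1 / p * ∫ x, |w x| ^ p) < 0 := by
    have : 0 < p := by linarith
    exact neg_neg_of_pos (by positivity)
  obtain ⟨ε, hlt, hε⟩ := (((h.mono_left nhdsWithin_le_nhds).eventually_lt_const hneg).and
    (self_mem_nhdsWithin (s := Ioi (0 : ℝ)))).exists
  replace hε : 0 < ε := hε
  refine ⟨_, hw.dilate hε, ?_⟩
  have e : ε ^ 2 = ε ^ ((p - 2) / 2) * ε ^ ((6 - p) / 2) := by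
    rw [← Real.rpow_add hε, ← Real.rpow_two]; congr 1; ring
  rw [energy_dilate hq hqp hμ hw hε, e, zero_div]
  have := mul_neg_of_pos_of_neg (Real.rpow_pos_of_pos hε ((p - 2) / 2)) hlt
  linarith

lemma energy_sub (hq : 2 < q) (hqp : q < p) (hμ : 0 < μ) (hv : InH1mass μ v) (α β : ℝ) :
    NLSenergy p q β v = NLSenergy p q α v - (β - α) / q * ∫ x, |v x| ^ q := by
  rw [NLSenergy_eq hμ hv hq hqp, NLSenergy_eq hμ hv hq hqp]; ring

lemma exists_lt_energy_neg (hq : 2 < q) (hqp : q < p) (hμ : 0 < μ) (hv : InH1mass μ v)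
    (h : NLSenergy p q α v < 0) : ∃ β < α, NLSenergy p q β v < 0 := by
  have hc : Continuous fun β => NLSenergy p q α v - (β - α) / q * ∫ x, |v x| ^ q := by fun_prop
  have ht := hc.tendsto α
  simp only [sub_self, zero_div, zero_mul, sub_zero] at ht
  obtain ⟨β, h1, h2⟩ := (((ht.mono_left nhdsWithin_le_nhds).eventually_lt_const h).and
    (self_mem_nhdsWithin (s := Iio α))).exists
  exact ⟨β, h2, by rwa [energy_sub hq hqp hμ hv α]⟩

end Scaling

section GroundLevel

variable {p q α μ : ℝ}

lemma groundLevel_neg_iff :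
    groundLevel p q α μ < 0 ↔ ∃ v, InH1mass μ v ∧ NLSenergy p q α v < 0 := by
  simp only [groundLevel, sInf_lt_iff, mem_image, mem_ofPred_eq]
  constructor
  · rintro ⟨_, ⟨v, hv, rfl⟩, h⟩
    exact ⟨v, hv, EReal.coe_neg'.1 h⟩
  · rintro ⟨v, hv, h⟩
    exact ⟨_, ⟨v, hv, rfl⟩, EReal.coe_neg'.2 h⟩

lemma groundLevel_nonpos (hq : 2 < q) (hqp : q < p) (hμ : 0 < μ) (α : ℝ) :
    groundLevel p q α μ ≤ 0 := by
  refine EReal.le_of_forall_lt_iff_le.1 fun δ hδ => ?_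
  obtain ⟨v, hv, h⟩ := exists_energy_lt hq hqp hμ α (EReal.coe_pos.1 hδ)
  have hle : groundLevel p q α μ ≤ (NLSenergy p q α v : EReal) := sInf_le ⟨v, hv, rfl⟩
  exact hle.trans (EReal.coe_le_coe_iff.2 h.le)

lemma energy_eq_groundLevel {u : ℝ → ℝ} (hu : InH1mass μ u)
    (hmin : ∀ v, InH1mass μ v → NLSenergy p q α u ≤ NLSenergy p q α v) :
    ((NLSenergy p q α u : ℝ) : EReal) = groundLevel p q α μ := by
  refine le_antisymm (le_sInf ?_) (sInf_le ⟨u, hu, rfl⟩)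
  rintro _ ⟨v, hv, rfl⟩
  exact EReal.coe_le_coe_iff.2 (hmin v hv)

lemma exists_groundState (hq : 2 < q) (hqp : q < p) (hp : p < 6) (hμ : 0 < μ) (hα : α < 0)
    (h : ∃ N, 0 ≤ N ∧ 0 ≤ nlsExcess p q α N ∧ profileLevel (nlsPot p q α) μ N ≤ 0) :
    ∃ u, InH1mass μ u ∧ ((NLSenergy p q α u : ℝ) : EReal) = groundLevel p q α μ := by
  obtain ⟨N, hN, hex, hle⟩ := h
  obtain ⟨u, hu, -, hmin⟩ := exists_minimizer hq hqp hp hμ hα hN hex hle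
  exact ⟨u, hu, energy_eq_groundLevel hu hmin⟩

lemma exists_profileLevel_of_groundLevel_neg (hq : 2 < q) (hqp : q < p) (hμ : 0 < μ)
    (h : groundLevel p q α μ < 0) :
    ∃ N, 0 ≤ N ∧ 0 ≤ nlsExcess p q α N ∧ profileLevel (nlsPot p q α) μ N ≤ 0 := by
  obtain ⟨v, hv, hE⟩ := groundLevel_neg_iff.1 h
  obtain ⟨N, hN, hex, hlt⟩ := exists_profileLevel_of_energy_neg hq hqp hμ hv hE
  exact ⟨N, hN, hex, hlt.le⟩

lemma energy_lt_energy (hq : 2 < q) (hqp : q < p) (hμ : 0 < μ) {v : ℝ → ℝ} (hv : InH1mass μ v)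
    {β : ℝ} (h : α < β) : NLSenergy p q β v < NLSenergy p q α v := by
  rw [energy_sub hq hqp hμ hv α β]
  have h1 := hv.integral_abs_rpow_pos hμ hq
  have h2 : 0 < (β - α) / q := div_pos (by linarith) (by linarith)
  linarith [mul_pos h2 h1]

lemma groundLevel_neg_of_lt (hq : 2 < q) (hqp : q < p) (hμ : 0 < μ) {β : ℝ} (hαβ : α < β)
    (h : groundLevel p q α μ < 0) : groundLevel p q β μ < 0 := by
  obtain ⟨v, hv, hE⟩ := groundLevel_neg_iff.1 h
  exact groundLevel_neg_iff.2 ⟨v, hv, (energy_lt_energy hq hqp hμ hv hαβ).trans hE⟩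

lemma bddBelow_setOf_groundLevel_neg (hq : 2 < q) (hqp : q < p) (hp : p < 6) (hμ : 0 < μ) :
    BddBelow {α : ℝ | α < 0 ∧ groundLevel p q α μ < 0} := by
  obtain ⟨R, hR, hRpos⟩ := exists_forall_profileLevel_pos hq hqp hp μ
  refine ⟨-(q / 2) * (2 / p * R ^ ((p - q) / 2)), fun α ⟨hα, h⟩ => ?_⟩
  obtain ⟨N, hN, hex, hle⟩ := exists_profileLevel_of_groundLevel_neg hq hqp hμ h
  have hNR : N < R := lt_of_not_ge fun h3 => (hRpos α hα.le _ h3 hex).not_ge hle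
  have := hex.trans (nlsExcess_mono hq hqp hN hNR.le)
  rw [nlsExcess] at this
  have hq0 : 0 < q := by linarith
  have e : q / 2 * (2 * α / q) = α := by field_simp
  nlinarith [mul_nonneg (half_pos hq0).le this]

lemma exists_profileLevel_sInf (hq : 2 < q) (hqp : q < p) (hp : p < 6) (hμ : 0 < μ)
    (hne : {α : ℝ | α < 0 ∧ groundLevel p q α μ < 0}.Nonempty) :
    ∃ N, 0 ≤ N ∧ 0 ≤ nlsExcess p q (sInf {α : ℝ | α < 0 ∧ groundLevel p q α μ < 0}) N ∧
      profileLevel (nlsPot p q (sInf {α : ℝ | α < 0 ∧ groundLevel p q α μ < 0})) μ N ≤ 0 := by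
  have hbdd := bddBelow_setOf_groundLevel_neg hq hqp hp hμ
  set S := {α : ℝ | α < 0 ∧ groundLevel p q α μ < 0}
  obtain ⟨R, hR, hRpos⟩ := exists_forall_profileLevel_pos hq hqp hp μ
  have hC : IsCompact (Icc (sInf S) 0 ×ˢ Icc 0 R ∩
      ({z : ℝ × ℝ | 0 ≤ nlsExcess p q z.1 z.2} ∩
        {z | profileLevel (nlsPot p q z.1) μ z.2 ≤ 0})) :=
    (isCompact_Icc.prod isCompact_Icc).inter_right
      ((isClosed_le continuous_const (continuous_nlsExcess_uncurry hqp)).inter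
        (isClosed_le (continuous_profileLevel_nlsPot hq hqp μ) continuous_const))
  have hsub : S ⊆ Prod.fst '' (Icc (sInf S) 0 ×ˢ Icc 0 R ∩
      ({z : ℝ × ℝ | 0 ≤ nlsExcess p q z.1 z.2} ∩
        {z | profileLevel (nlsPot p q z.1) μ z.2 ≤ 0})) := fun α hα => by
    obtain ⟨N, hN, hex, hle⟩ := exists_profileLevel_of_groundLevel_neg hq hqp hμ hα.2
    have hNR : N < R := lt_of_not_ge fun h3 => (hRpos α hα.1.le _ h3 hex).not_ge hle
    exact ⟨(α, N), ⟨⟨⟨csInf_le hbdd hα, hα.1.le⟩, hN, hNR.le⟩, hex, hle⟩, rfl⟩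
  obtain ⟨⟨α, N⟩, ⟨⟨-, hN⟩, hex, hle⟩, hα⟩ :=
    (hC.image continuous_fst).isClosed.closure_subset_iff.2 hsub (csInf_mem_closure hne hbdd)
  rw [← hα]
  exact ⟨N, hN.1, hex, hle⟩

end GroundLevel

/-- the critical coefficient ᾱ in the defocusing subcritical case:
finiteness, negativity, existence for ᾱ ≤ α < 0, and non-existence for α < ᾱ. -/
theorem defocusing_critical_alpha
    (p q μ : ℝ) (hq : 2 < q) (hqp : q < p) (hp : p < 6) (hμ : 0 < μ)
    (abar : ℝ)
    (habar : abar = sInf {α : ℝ | α < 0 ∧ groundLevel p q α μ < 0}) :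
    {α : ℝ | α < 0 ∧ groundLevel p q α μ < 0}.Nonempty ∧
    BddBelow {α : ℝ | α < 0 ∧ groundLevel p q α μ < 0} ∧
    abar < 0 ∧
    (∀ α : ℝ, abar < α → α < 0 →
      groundLevel p q α μ < 0 ∧
      ∃ u : ℝ → ℝ, InH1mass μ u ∧
        ((NLSenergy p q α u : ℝ) : EReal) = groundLevel p q α μ) ∧
    (groundLevel p q abar μ = 0 ∧
      ∃ u : ℝ → ℝ, InH1mass μ u ∧
        ((NLSenergy p q abar u : ℝ) : EReal) = groundLevel p q abar μ) ∧
    (∀ α : ℝ, α < abar →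
      groundLevel p q α μ = 0 ∧
      ¬ ∃ u : ℝ → ℝ, InH1mass μ u ∧
        ((NLSenergy p q α u : ℝ) : EReal) = groundLevel p q α μ) := by
  have hbdd := bddBelow_setOf_groundLevel_neg hq hqp hp hμ
  have hmem : ∀ {α v}, InH1mass μ v → α < 0 → NLSenergy p q α v < 0 →
      α ∈ {α : ℝ | α < 0 ∧ groundLevel p q α μ < 0} := fun hv hα h =>
    ⟨hα, groundLevel_neg_iff.2 ⟨_, hv, h⟩⟩
  obtain ⟨v₀, hv₀, hE₀⟩ := exists_energy_zero_neg hq hqp hp hμ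
  obtain ⟨β₀, hβ₀, hEβ₀⟩ := exists_lt_energy_neg hq hqp hμ hv₀ hE₀
  have hne : {α : ℝ | α < 0 ∧ groundLevel p q α μ < 0}.Nonempty := ⟨β₀, hmem hv₀ hβ₀ hEβ₀⟩
  have hlower : ∀ {α}, α ∈ {α : ℝ | α < 0 ∧ groundLevel p q α μ < 0} → abar ≤ α := fun h =>
    habar.trans_le (csInf_le hbdd h)
  have hneg : abar < 0 := (hlower (hmem hv₀ hβ₀ hEβ₀)).trans_lt hβ₀
  refine ⟨hne, hbdd, hneg, fun α h1 h2 => ?_, ⟨?_, ?_⟩, fun α h1 => ?_⟩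
  · rw [habar] at h1
    obtain ⟨β, hβ, hβα⟩ := exists_lt_of_csInf_lt hne h1
    have h := groundLevel_neg_of_lt hq hqp hμ hβα hβ.2
    exact ⟨h, exists_groundState hq hqp hp hμ h2
      (exists_profileLevel_of_groundLevel_neg hq hqp hμ h)⟩
  · refine (groundLevel_nonpos hq hqp hμ abar).eq_of_not_lt fun h => ?_
    obtain ⟨v, hv, hE⟩ := groundLevel_neg_iff.1 h
    obtain ⟨β, hβ, hEβ⟩ := exists_lt_energy_neg hq hqp hμ hv hE
    exact (hlower (hmem hv (hβ.trans hneg) hEβ)).not_gt hβ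
  · refine exists_groundState hq hqp hp hμ hneg ?_
    rw [habar]
    exact exists_profileLevel_sInf hq hqp hp hμ hne
  · have h0 : groundLevel p q α μ = 0 := (groundLevel_nonpos hq hqp hμ α).eq_of_not_lt fun h =>
      (hlower ⟨h1.trans hneg, h⟩).not_gt h1
    refine ⟨h0, fun ⟨u, hu, hE⟩ => ?_⟩
    rw [h0, EReal.coe_eq_zero] at hE
    obtain ⟨β, hαβ, hβ⟩ := exists_between h1
    have := energy_lt_energy hq hqp hμ hu hαβ
    rw [hE] at this
    exact (hlower (hmem hu (hβ.trans hneg) this)).not_gt hβ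
end

section
/- Let 2 < p < 6 and μ > 0, and define the homogeneous NLS energy E_p(u) := ∫_ℝ ((1/2)|u′(x)|² − (1/p)|u(x)|^p) dx. Then −∞ < inf{E_p(u) : u ∈ H¹_μ(ℝ)} < 0 and the infimum is attained by some u ∈ H¹_μ(ℝ). -/
open MeasureTheory

/-- The homogeneous NLS energy on the real line. -/
noncomputable def homNLSenergy (p : ℝ) (u : ℝ → ℝ) : ℝ :=
  ∫ x : ℝ, ((1 / 2) * (deriv u x) ^ 2 - (1 / p) * |u x| ^ p)

open Filter Set Topology

/-! ### Amplitude scaling -/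

/-- The scaling `u ↦ M u(M ^ ((p - 2) / 2) ·)`, which acts on the energy by a power of `M`. -/
noncomputable def nlsScale (p M : ℝ) (u : ℝ → ℝ) (x : ℝ) : ℝ :=
  M * u (M ^ ((p - 2) / 2) * x)

lemma deriv_nlsScale (p M : ℝ) (u : ℝ → ℝ) (x : ℝ) :
    deriv (nlsScale p M u) x =
      M * (M ^ ((p - 2) / 2) * deriv u (M ^ ((p - 2) / 2) * x)) := by
  unfold nlsScale
  rw [deriv_const_mul_field, deriv_comp_mul_left, smul_eq_mul]

lemma homNLSenergy_nlsScale {p M : ℝ} (hM : 0 < M) (u : ℝ → ℝ) :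
    homNLSenergy p (nlsScale p M u) = M ^ ((p + 2) / 2) * homNLSenergy p u := by
  set β := M ^ ((p - 2) / 2) with hβ
  have hβ0 : 0 < β := by positivity
  have hβ2 : M ^ 2 * β ^ 2 = M ^ p := by
    rw [hβ, ← Real.rpow_natCast, ← Real.rpow_natCast, ← Real.rpow_mul hM.le,
      ← Real.rpow_add hM]
    congr 1
    push_cast
    ring
  have hpow : M ^ p * β⁻¹ = M ^ ((p + 2) / 2) := by
    rw [hβ, ← Real.rpow_neg hM.le, ← Real.rpow_add hM]
    congr 1
    ring
  have key : ∀ x, (1 / 2) * (deriv (nlsScale p M u) x) ^ 2 - (1 / p) * |nlsScale p M u x| ^ p =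
      M ^ p * (fun y => (1 / 2) * (deriv u y) ^ 2 - (1 / p) * |u y| ^ p) (β * x) := by
    intro x
    rw [deriv_nlsScale, ← hβ]
    simp only [nlsScale, ← hβ]
    rw [abs_mul, abs_of_pos hM, Real.mul_rpow hM.le (abs_nonneg _), ← hβ2]
    ring
  unfold homNLSenergy
  rw [integral_congr_ae (ae_of_all _ key), integral_const_mul,
    Measure.integral_comp_mul_left (fun y => (1 / 2) * (deriv u y) ^ 2 - (1 / p) * |u y| ^ p), abs_of_pos (by positivity),
    smul_eq_mul, ← mul_assoc, hpow]

lemma InH1mass.nlsScale {p M μ : ℝ} (hM : 0 < M) {u : ℝ → ℝ} (hu : InH1mass μ u) :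
    InH1mass (M ^ ((6 - p) / 2) * μ) (nlsScale p M u) := by
  obtain ⟨hd, hi, hi', hm⟩ := hu
  have hβ0 : 0 < M ^ ((p - 2) / 2) := by positivity
  have hpow : M ^ 2 * (M ^ ((p - 2) / 2))⁻¹ = M ^ ((6 - p) / 2) := by
    rw [← Real.rpow_neg hM.le, ← Real.rpow_natCast, ← Real.rpow_add hM]
    congr 1
    push_cast
    ring
  refine ⟨?_, ?_, ?_, ?_⟩
  · unfold _root_.nlsScale
    fun_prop
  · simp_rw [_root_.nlsScale, mul_pow]
    exact (hi.comp_mul_left' hβ0.ne').const_mul _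
  · simp_rw [deriv_nlsScale, mul_pow]
    exact ((hi'.comp_mul_left' hβ0.ne').const_mul _).const_mul _
  · simp_rw [_root_.nlsScale, mul_pow]
    rw [integral_const_mul, Measure.integral_comp_mul_left (fun y => u y ^ 2),
      abs_of_pos (by positivity), smul_eq_mul, hm, ← mul_assoc, hpow]

/-! ### Decay and integrability of `H¹` functions -/

/-- If `u` and `u'` are square-integrable, then `u` vanishes at `±∞`. -/
lemma InH1mass.tendsto_zero {μ : ℝ} {u : ℝ → ℝ} (hu : InH1mass μ u) :
    Tendsto u atBot (𝓝 0) ∧ Tendsto u atTop (𝓝 0) := by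
  obtain ⟨hd, hi, hi', -⟩ := hu
  have hderiv : ∀ x, HasDerivAt (fun y => u y ^ 2) (2 * u x * deriv u x) x := fun x => by
    simpa using (hd x).hasDerivAt.fun_pow 2
  have hint : Integrable fun x => 2 * u x * deriv u x := by
    refine (hi.add hi').mono' ?_ (ae_of_all _ fun x => ?_)
    · exact ((hd.continuous.measurable.const_mul 2).mul (measurable_deriv u)).aestronglyMeasurable
    · rw [Real.norm_eq_abs, abs_le]
      simp only [Pi.add_apply]
      constructor <;> nlinarith [sq_nonneg (u x + deriv u x), sq_nonneg (u x - deriv u x)]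
  have aux : ∀ l : Filter ℝ, Tendsto (fun y => u y ^ 2) l (𝓝 0) → Tendsto u l (𝓝 0) := by
    intro l h
    rw [tendsto_zero_iff_abs_tendsto_zero]
    simpa [Function.comp_def, Real.sqrt_sq_eq_abs] using (Real.continuous_sqrt.tendsto 0).comp h
  exact ⟨aux _ (tendsto_zero_of_hasDerivAt_of_integrableOn_Iic (a := 0) (fun x _ => hderiv x)
      hint.integrableOn hi.integrableOn),
    aux _ (tendsto_zero_of_hasDerivAt_of_integrableOn_Ioi (a := 0) (fun x _ => hderiv x)
      hint.integrableOn hi.integrableOn)⟩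

lemma InH1mass.exists_abs_max {μ : ℝ} (hμ : 0 < μ) {u : ℝ → ℝ} (hu : InH1mass μ u) :
    ∃ x₀, 0 < |u x₀| ∧ ∀ x, |u x| ≤ |u x₀| := by
  obtain ⟨hbot, htop⟩ := hu.tendsto_zero
  obtain ⟨x₁, hx₁⟩ : ∃ x, u x ≠ 0 := by
    by_contra! h
    have := hu.2.2.2
    simp only [h] at this
    simp at this
    exact hμ.ne this
  have hev : ∀ᶠ x in cocompact ℝ, |u x| ≤ |u x₁| := by
    have h0 : Tendsto (fun x => |u x|) (cocompact ℝ) (𝓝 0) := by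
      rw [cocompact_eq_atBot_atTop]
      simpa using (hbot.sup htop).abs
    exact h0.eventually_le_const (abs_pos.2 hx₁)
  obtain ⟨x₀, hx₀⟩ := hu.1.continuous.abs.exists_forall_ge' x₁ hev
  exact ⟨x₀, (abs_pos.2 hx₁).trans_le (hx₀ x₁), hx₀⟩

lemma abs_rpow_le_sq {p s : ℝ} (hp : 2 ≤ p) (hs : |s| ≤ 1) : |s| ^ p ≤ s ^ 2 := by
  rcases (abs_nonneg s).eq_or_lt with h | h
  · rw [← h, Real.zero_rpow (by linarith)]
    positivity
  · rw [← sq_abs, ← Real.rpow_natCast]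
    exact Real.rpow_le_rpow_of_exponent_ge h hs (by exact_mod_cast hp)

lemma InH1mass.integrable_abs_rpow_s16 {p μ : ℝ} (hp : 2 ≤ p) {u : ℝ → ℝ} (hu : InH1mass μ u)
    (h1 : ∀ x, |u x| ≤ 1) : Integrable fun x => |u x| ^ p := by
  refine hu.2.1.mono' ?_ (ae_of_all _ fun x => ?_)
  · exact (hu.1.continuous.abs.rpow_const fun x => Or.inr (by linarith)).aestronglyMeasurable
  · rw [Real.norm_eq_abs, abs_of_nonneg (by positivity)]
    exact abs_rpow_le_sq hp (h1 x)

lemma InH1mass.homNLSenergy_eq {p μ : ℝ} (hp : 2 ≤ p) {u : ℝ → ℝ} (hu : InH1mass μ u)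
    (h1 : ∀ x, |u x| ≤ 1) :
    homNLSenergy p u = (1 / 2) * (∫ x, deriv u x ^ 2) - (1 / p) * ∫ x, |u x| ^ p := by
  unfold homNLSenergy
  rw [integral_sub (hu.2.2.1.const_mul _) ((hu.integrable_abs_rpow_s16 hp h1).const_mul _),
    integral_const_mul, integral_const_mul]

/-! ### The lower bound for functions with maximum one -/

/-- The speed `|u'|` of the ground state of height one, as a function of its value. -/
noncomputable def nlsSpeed (p s : ℝ) : ℝ :=
  √((2 / p) * (s ^ 2 - |s| ^ p))

/-- The primitive of `nlsSpeed` vanishing at the origin. -/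
noncomputable def nlsCost (p s : ℝ) : ℝ :=
  ∫ σ in (0 : ℝ)..s, nlsSpeed p σ

lemma continuous_nlsSpeed {p : ℝ} (hp : 0 ≤ p) : Continuous (nlsSpeed p) := by
  have := continuous_abs.rpow_const (f := fun s : ℝ => |s|) (p := p) fun _ => Or.inr hp
  unfold nlsSpeed
  fun_prop

lemma hasDerivAt_nlsCost {p : ℝ} (hp : 0 ≤ p) (s : ℝ) :
    HasDerivAt (nlsCost p) (nlsSpeed p s) s :=
  ((continuous_nlsSpeed hp).integral_hasStrictDerivAt 0 s).hasDerivAt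

lemma nlsSpeed_neg (p s : ℝ) : nlsSpeed p (-s) = nlsSpeed p s := by
  simp [nlsSpeed]

lemma nlsCost_neg (p s : ℝ) : nlsCost p (-s) = -nlsCost p s := by
  have := intervalIntegral.integral_comp_neg (a := 0) (b := s) (nlsSpeed p)
  simp only [nlsSpeed_neg, neg_zero] at this
  rw [nlsCost, nlsCost, this, intervalIntegral.integral_symm]

lemma nlsSpeed_sq {p s : ℝ} (hp : 2 ≤ p) (hs : |s| ≤ 1) :
    nlsSpeed p s ^ 2 = (2 / p) * (s ^ 2 - |s| ^ p) :=
  Real.sq_sqrt (mul_nonneg (by positivity) (sub_nonneg.2 (abs_rpow_le_sq hp hs)))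

section

variable {p μ : ℝ} {u : ℝ → ℝ}

lemma InH1mass.integrable_nlsSpeed_mul_deriv (hp : 2 ≤ p) (hu : InH1mass μ u)
    (h1 : ∀ x, |u x| ≤ 1) : Integrable fun x => nlsSpeed p (u x) * deriv u x := by
  refine ((hu.2.1.const_mul (2 / p)).add hu.2.2.1).mono' ?_ (ae_of_all _ fun x => ?_)
  · exact (((continuous_nlsSpeed (by linarith)).comp hu.1.continuous).measurable.mul
      (measurable_deriv u)).aestronglyMeasurable
  · have h := nlsSpeed_sq hp (h1 x)
    have h0 : 0 ≤ 2 / p * |u x| ^ p := by positivity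
    rw [Real.norm_eq_abs, abs_le]
    simp only [Pi.add_apply]
    constructor <;> nlinarith [sq_nonneg (nlsSpeed p (u x) + deriv u x),
      sq_nonneg (nlsSpeed p (u x) - deriv u x)]

lemma InH1mass.hasDerivAt_nlsCost_comp (hp : 2 ≤ p) (hu : InH1mass μ u) (x : ℝ) :
    HasDerivAt (fun y => nlsCost p (u y)) (nlsSpeed p (u x) * deriv u x) x :=
  (hasDerivAt_nlsCost (by linarith) (u x)).comp x (hu.1 x).hasDerivAt

lemma tendsto_nlsCost_comp (hp : 2 ≤ p) {l : Filter ℝ} (hl : Tendsto u l (𝓝 0)) :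
    Tendsto (fun y => nlsCost p (u y)) l (𝓝 0) := by
  have h := (hasDerivAt_nlsCost (p := p) (by linarith) 0).continuousAt.tendsto.comp hl
  simpa [nlsCost, Function.comp_def] using h

lemma InH1mass.setIntegral_Iic_nlsSpeed (hp : 2 ≤ p) (hu : InH1mass μ u)
    (h1 : ∀ x, |u x| ≤ 1) (a : ℝ) :
    ∫ x in Iic a, nlsSpeed p (u x) * deriv u x = nlsCost p (u a) := by
  rw [integral_Iic_of_hasDerivAt_of_tendsto' (fun x _ => hu.hasDerivAt_nlsCost_comp hp x)
    (hu.integrable_nlsSpeed_mul_deriv hp h1).integrableOn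
    (tendsto_nlsCost_comp hp hu.tendsto_zero.1), sub_zero]

lemma InH1mass.setIntegral_Ioi_nlsSpeed (hp : 2 ≤ p) (hu : InH1mass μ u)
    (h1 : ∀ x, |u x| ≤ 1) (a : ℝ) :
    ∫ x in Ioi a, nlsSpeed p (u x) * deriv u x = -nlsCost p (u a) := by
  rw [integral_Ioi_of_hasDerivAt_of_tendsto' (fun x _ => hu.hasDerivAt_nlsCost_comp hp x)
    (hu.integrable_nlsSpeed_mul_deriv hp h1).integrableOn
    (tendsto_nlsCost_comp hp hu.tendsto_zero.2), zero_sub]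

lemma InH1mass.two_mul_nlsCost_one_le (hp : 2 ≤ p) (hu : InH1mass μ u)
    (h1 : ∀ x, |u x| ≤ 1) {a : ℝ} (ha : |u a| = 1) :
    2 * nlsCost p 1 ≤ homNLSenergy p u + μ / p := by
  have hI := (hu.integrable_nlsSpeed_mul_deriv hp h1)
  have hcost : nlsCost p 1 ≤ |nlsCost p (u a)| := by
    rcases eq_or_eq_neg_of_abs_eq ha with h | h
    · rw [h]; exact le_abs_self _
    · rw [h, nlsCost_neg, abs_neg]; exact le_abs_self _
  have hsplit : 2 * |nlsCost p (u a)| ≤ ∫ x, |nlsSpeed p (u x) * deriv u x| := by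
    have hl := abs_integral_le_integral_abs (μ := volume.restrict (Iic a))
      (f := fun x => nlsSpeed p (u x) * deriv u x)
    have hr := abs_integral_le_integral_abs (μ := volume.restrict (Ioi a))
      (f := fun x => nlsSpeed p (u x) * deriv u x)
    rw [hu.setIntegral_Iic_nlsSpeed hp h1] at hl
    rw [hu.setIntegral_Ioi_nlsSpeed hp h1, abs_neg] at hr
    have hs := intervalIntegral.integral_Iic_add_Ioi (b := a) hI.abs.integrableOn hI.abs.integrableOn
    linarith
  have hE : homNLSenergy p u + μ / p =
      ∫ x, ((1 / 2) * deriv u x ^ 2 - (1 / p) * |u x| ^ p + (1 / p) * u x ^ 2) := by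
    have i₁ : Integrable fun x => (1 / 2) * deriv u x ^ 2 - (1 / p) * |u x| ^ p :=
      (hu.2.2.1.const_mul _).sub ((hu.integrable_abs_rpow_s16 hp h1).const_mul _)
    rw [integral_add i₁ (hu.2.1.const_mul _), integral_const_mul, hu.2.2.2, homNLSenergy]
    ring
  have hle : ∫ x, |nlsSpeed p (u x) * deriv u x| ≤
      ∫ x, ((1 / 2) * deriv u x ^ 2 - (1 / p) * |u x| ^ p + (1 / p) * u x ^ 2) := by
    refine integral_mono hI.abs (((hu.2.2.1.const_mul (1 / 2)).sub
      ((hu.integrable_abs_rpow_s16 hp h1).const_mul (1 / p))).add (hu.2.1.const_mul _)) fun x => ?_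
    have h := nlsSpeed_sq hp (h1 x)
    have h' : (1 / 2) * nlsSpeed p (u x) ^ 2 = (1 / p) * u x ^ 2 - (1 / p) * |u x| ^ p := by
      rw [h]; ring
    rw [abs_le]
    constructor <;> nlinarith [sq_nonneg (nlsSpeed p (u x) + deriv u x),
      sq_nonneg (nlsSpeed p (u x) - deriv u x)]
  linarith

end

/-! ### The ground state of height one -/

/-- The rate in the hyperbolic cosine of the ground state of height one. -/
noncomputable def nlsRate (p : ℝ) : ℝ :=
  (p - 2) / 2 * √(2 / p)

/-- The ground state of height one. -/
noncomputable def nlsProfile (p x : ℝ) : ℝ :=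
  Real.cosh (nlsRate p * x) ^ (-(2 / (p - 2)))

section

variable {p : ℝ}

lemma nlsProfile_pos (p x : ℝ) : 0 < nlsProfile p x :=
  Real.rpow_pos_of_pos (Real.cosh_pos _) _

lemma nlsProfile_zero (p : ℝ) : nlsProfile p 0 = 1 := by
  simp [nlsProfile]

lemma abs_nlsProfile_le_one (hp : 2 < p) (x : ℝ) : |nlsProfile p x| ≤ 1 := by
  rw [abs_of_pos (nlsProfile_pos p x)]
  have : 0 < p - 2 := by linarith
  exact Real.rpow_le_one_of_one_le_of_nonpos (Real.one_le_cosh _) (neg_nonpos.2 (by positivity))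

lemma hasDerivAt_cosh_rate_rpow (p e x : ℝ) :
    HasDerivAt (fun y => Real.cosh (nlsRate p * y) ^ e)
      (e * nlsRate p * Real.sinh (nlsRate p * x) * Real.cosh (nlsRate p * x) ^ (e - 1)) x := by
  have h : HasDerivAt (fun y => Real.cosh (nlsRate p * y))
      (Real.sinh (nlsRate p * x) * nlsRate p) x := by
    simpa using ((hasDerivAt_id x).const_mul (nlsRate p)).cosh
  convert h.rpow_const (p := e) (Or.inl (Real.cosh_pos _).ne') using 1
  ring

lemma deriv_nlsProfile (hp : 2 < p) (x : ℝ) :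
    deriv (nlsProfile p) x = -√(2 / p) * Real.sinh (nlsRate p * x) *
      Real.cosh (nlsRate p * x) ^ (-(2 / (p - 2)) - 1) := by
  refine (hasDerivAt_cosh_rate_rpow p _ x).deriv.trans ?_
  have : p - 2 ≠ 0 := by linarith
  congr 2
  unfold nlsRate
  field_simp

lemma differentiable_nlsProfile (p : ℝ) : Differentiable ℝ (nlsProfile p) :=
  fun x => (hasDerivAt_cosh_rate_rpow p _ x).differentiableAt

lemma nlsProfile_sq (p x : ℝ) :
    nlsProfile p x ^ 2 = Real.cosh (nlsRate p * x) ^ (-(4 / (p - 2))) := by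
  rw [nlsProfile, ← Real.rpow_natCast, ← Real.rpow_mul (Real.cosh_pos _).le]
  congr 1
  push_cast
  ring

lemma abs_nlsProfile_rpow (hp : 2 < p) (x : ℝ) :
    |nlsProfile p x| ^ p = Real.cosh (nlsRate p * x) ^ (-(4 / (p - 2)) - 2) := by
  have : p - 2 ≠ 0 := by linarith
  rw [abs_of_pos (nlsProfile_pos p x), nlsProfile, ← Real.rpow_mul (Real.cosh_pos _).le]
  congr 1
  field_simp
  ring

lemma cosh_rate_rpow_split (e y : ℝ) :
    Real.cosh y ^ e = Real.cosh y ^ 2 * Real.cosh y ^ (e - 2) := by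
  rw [← Real.rpow_natCast, ← Real.rpow_add (Real.cosh_pos _)]
  congr 1
  push_cast
  ring

lemma deriv_nlsProfile_sq (hp : 2 < p) (x : ℝ) :
    deriv (nlsProfile p) x ^ 2 = (2 / p) * (nlsProfile p x ^ 2 - |nlsProfile p x| ^ p) := by
  have hsq : (Real.cosh (nlsRate p * x) ^ (-(2 / (p - 2)) - 1)) ^ 2 =
      Real.cosh (nlsRate p * x) ^ (-(4 / (p - 2)) - 2) := by
    rw [← Real.rpow_natCast, ← Real.rpow_mul (Real.cosh_pos _).le]
    congr 1
    push_cast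
    ring
  rw [nlsProfile_sq, abs_nlsProfile_rpow hp, deriv_nlsProfile hp, mul_pow, mul_pow, neg_sq,
    Real.sq_sqrt (by positivity), hsq, cosh_rate_rpow_split (-(4 / (p - 2))), Real.sinh_sq]
  ring

lemma nlsSpeed_nlsProfile (hp : 2 < p) (x : ℝ) :
    nlsSpeed p (nlsProfile p x) = |deriv (nlsProfile p) x| := by
  rw [nlsSpeed, ← deriv_nlsProfile_sq hp, Real.sqrt_sq_eq_abs]

lemma nlsRate_pos (hp : 2 < p) : 0 < nlsRate p := by
  have : 0 < p - 2 := by linarith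
  unfold nlsRate
  positivity

lemma integrable_nlsProfile_sq (hp : 2 < p) : Integrable fun x => nlsProfile p x ^ 2 := by
  have hp' : 0 < p - 2 := by linarith
  have hk := nlsRate_pos hp
  have hcont : Continuous fun x => nlsProfile p x ^ 2 :=
    (differentiable_nlsProfile p).continuous.pow 2
  refine hcont.locallyIntegrable.integrable_of_isBigO_atTop_of_norm_isNegInvariant
    (g := fun x => Real.exp (-(4 / (p - 2) * nlsRate p) * x)) ?_ ?_ ?_
  · exact ae_of_all _ fun x => by simp [nlsProfile]
  · refine Asymptotics.IsBigO.of_bound (2 ^ (4 / (p - 2))) (Eventually.of_forall fun x => ?_)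
    rw [Real.norm_eq_abs, Real.norm_eq_abs, Real.abs_exp, abs_of_nonneg (by positivity),
      nlsProfile_sq]
    have hc : Real.exp (nlsRate p * x) / 2 ≤ Real.cosh (nlsRate p * x) := by
      rw [Real.cosh_eq]
      linarith [Real.exp_pos (-(nlsRate p * x))]
    refine (Real.rpow_le_rpow_of_nonpos (by positivity) hc
      (neg_nonpos.2 (by positivity))).trans_eq ?_
    rw [Real.div_rpow (Real.exp_pos _).le (by norm_num), ← Real.exp_mul, Real.rpow_neg (by norm_num),
      div_inv_eq_mul, mul_comm]
    congr 2
    ring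
  · exact ⟨Ioi 0, Ioi_mem_atTop 0, integrableOn_exp_mul_Ioi (by
      rw [neg_lt_zero]; positivity) 0⟩

lemma inH1mass_nlsProfile (hp : 2 < p) :
    InH1mass (∫ x, nlsProfile p x ^ 2) (nlsProfile p) := by
  have hi := integrable_nlsProfile_sq hp
  refine ⟨differentiable_nlsProfile p, hi, (hi.const_mul (2 / p)).mono' ?_ ?_, rfl⟩
  · exact ((measurable_deriv _).pow_const 2).aestronglyMeasurable
  · refine ae_of_all _ fun x => ?_
    rw [Real.norm_eq_abs, abs_of_nonneg (by positivity), deriv_nlsProfile_sq hp]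
    gcongr
    linarith [show 0 ≤ |nlsProfile p x| ^ p by positivity]

lemma integral_nlsProfile_sq_pos (hp : 2 < p) : 0 < ∫ x, nlsProfile p x ^ 2 := by
  rw [integral_pos_iff_support_of_nonneg (fun x => by positivity) (integrable_nlsProfile_sq hp)]
  have : Function.support (fun x => nlsProfile p x ^ 2) = univ := by
    ext x
    simp [(nlsProfile_pos p x).ne']
  simp [this]

lemma integral_deriv_nlsProfile_sq_eq_cost (hp : 2 < p) :
    ∫ x, deriv (nlsProfile p) x ^ 2 = 2 * nlsCost p 1 := by
  have hu := inH1mass_nlsProfile hp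
  have h1 := abs_nlsProfile_le_one hp
  have hk := nlsRate_pos hp
  have hsign : ∀ x, deriv (nlsProfile p) x = -Real.sinh (nlsRate p * x) *
      (√(2 / p) * Real.cosh (nlsRate p * x) ^ (-(2 / (p - 2)) - 1)) := fun x => by
    rw [deriv_nlsProfile hp]; ring
  have hfac : ∀ x, 0 ≤ √(2 / p) * Real.cosh (nlsRate p * x) ^ (-(2 / (p - 2)) - 1) := fun x =>
    mul_nonneg (Real.sqrt_nonneg _) (Real.rpow_nonneg (Real.cosh_pos _).le _)
  have hl : ∫ x in Iic 0, deriv (nlsProfile p) x ^ 2 = nlsCost p 1 := by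
    rw [← nlsProfile_zero p, ← hu.setIntegral_Iic_nlsSpeed hp.le h1 0]
    refine setIntegral_congr_fun measurableSet_Iic fun x hx => ?_
    have : 0 ≤ deriv (nlsProfile p) x := by
      rw [hsign]
      exact mul_nonneg (neg_nonneg.2 (Real.sinh_nonpos_iff.2
        (mul_nonpos_of_nonneg_of_nonpos hk.le hx))) (hfac x)
    simp only [nlsSpeed_nlsProfile hp, abs_of_nonneg this, sq]
  have hr : ∫ x in Ioi 0, deriv (nlsProfile p) x ^ 2 = nlsCost p 1 := by
    rw [← nlsProfile_zero p, ← neg_neg (nlsCost p _), ← hu.setIntegral_Ioi_nlsSpeed hp.le h1 0,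
      ← integral_neg]
    refine setIntegral_congr_fun measurableSet_Ioi fun x hx => ?_
    have : deriv (nlsProfile p) x ≤ 0 := by
      rw [hsign]
      exact mul_nonpos_of_nonpos_of_nonneg (neg_nonpos.2 (Real.sinh_nonneg_iff.2
        (mul_nonneg hk.le (mem_Ioi.1 hx).le))) (hfac x)
    simp only [nlsSpeed_nlsProfile hp, abs_of_nonpos this]
    ring
  rw [← intervalIntegral.integral_Iic_add_Ioi (b := 0) hu.2.2.1.integrableOn
    hu.2.2.1.integrableOn, hl, hr]
  ring

lemma hasDerivAt_nlsProfile_mul_deriv (hp : 2 < p) (x : ℝ) :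
    HasDerivAt (fun y => nlsProfile p y * deriv (nlsProfile p) y)
      ((4 / p) * nlsProfile p x ^ 2 - ((p + 2) / p) * |nlsProfile p x| ^ p) x := by
  have hp0 : p ≠ 0 := by linarith
  have hp2 : p - 2 ≠ 0 := by linarith
  have hfun : (fun y => nlsProfile p y * deriv (nlsProfile p) y) = fun y =>
      -√(2 / p) * (Real.sinh (nlsRate p * y) *
        Real.cosh (nlsRate p * y) ^ (-(4 / (p - 2)) - 1)) := by
    funext y
    have : Real.cosh (nlsRate p * y) ^ (-(4 / (p - 2)) - 1) =
        Real.cosh (nlsRate p * y) ^ (-(2 / (p - 2))) *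
          Real.cosh (nlsRate p * y) ^ (-(2 / (p - 2)) - 1) := by
      rw [← Real.rpow_add (Real.cosh_pos _)]
      congr 1
      ring
    rw [deriv_nlsProfile hp, nlsProfile, this]
    ring
  have hs : HasDerivAt (fun y => Real.sinh (nlsRate p * y))
      (Real.cosh (nlsRate p * x) * nlsRate p) x := by
    simpa using ((hasDerivAt_id x).const_mul (nlsRate p)).sinh
  rw [hfun]
  refine ((hs.fun_mul (hasDerivAt_cosh_rate_rpow p (-(4 / (p - 2)) - 1) x)).const_mul
    (-√(2 / p))).congr_deriv (Eq.symm ?_)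
  have h2 : √(2 / p) ^ 2 = 2 / p := Real.sq_sqrt (div_nonneg zero_le_two (by linarith))
  have hc : Real.cosh (nlsRate p * x) * Real.cosh (nlsRate p * x) ^ (-(4 / (p - 2)) - 1) =
      Real.cosh (nlsRate p * x) ^ 2 * Real.cosh (nlsRate p * x) ^ (-(4 / (p - 2)) - 2) := by
    rw [← cosh_rate_rpow_split, mul_comm, ← Real.rpow_add_one (Real.cosh_pos _).ne']
    congr 1
    ring
  rw [nlsProfile_sq, abs_nlsProfile_rpow hp, cosh_rate_rpow_split (-(4 / (p - 2))),
    show -(4 / (p - 2)) - 1 - 1 = -(4 / (p - 2)) - 2 by ring]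
  set C := Real.cosh (nlsRate p * x)
  set S := Real.sinh (nlsRate p * x)
  set D := C ^ (-(4 / (p - 2)) - 2)
  have hS : S ^ 2 = C ^ 2 - 1 := Real.sinh_sq _
  have hω : √(2 / p) * nlsRate p = (p - 2) / p := by
    rw [nlsRate, mul_comm, mul_assoc, ← sq, h2]
    field_simp
  calc (4 / p) * (C ^ 2 * D) - ((p + 2) / p) * D
      = -((p - 2) / p) * (C ^ 2 * D + (-(4 / (p - 2)) - 1) * (C ^ 2 - 1) * D) := by
        field_simp
        ring
    _ = _ := by
        rw [← hω, ← hS, ← hc]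
        ring

lemma integral_abs_nlsProfile_rpow (hp : 2 < p) :
    ∫ x, |nlsProfile p x| ^ p = 4 / (p + 2) * ∫ x, nlsProfile p x ^ 2 := by
  have hu := inH1mass_nlsProfile hp
  have hi := (hu.2.1.const_mul (4 / p))
  have hi' := ((hu.integrable_abs_rpow_s16 hp.le (abs_nlsProfile_le_one hp)).const_mul ((p + 2) / p))
  have hQ : Integrable fun y => nlsProfile p y * deriv (nlsProfile p) y := by
    refine (hu.2.1.add hu.2.2.1).mono' ?_ (ae_of_all _ fun x => ?_)
    · exact (hu.1.continuous.measurable.mul (measurable_deriv _)).aestronglyMeasurable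
    · rw [Real.norm_eq_abs, abs_le]
      simp only [Pi.add_apply]
      constructor <;> nlinarith [sq_nonneg (nlsProfile p x + deriv (nlsProfile p) x),
        sq_nonneg (nlsProfile p x - deriv (nlsProfile p) x)]
  have h := integral_eq_zero_of_hasDerivAt_of_integrable (hasDerivAt_nlsProfile_mul_deriv hp)
    (hi.sub hi') hQ
  rw [integral_sub hi hi', integral_const_mul, integral_const_mul] at h
  have hp0 : 0 < p := by linarith
  field_simp at h ⊢
  linarith

lemma two_mul_nlsCost_one (hp : 2 < p) :
    2 * nlsCost p 1 = 2 * (p - 2) / (p * (p + 2)) * ∫ x, nlsProfile p x ^ 2 := by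
  have hu := inH1mass_nlsProfile hp
  have hi := hu.integrable_abs_rpow_s16 hp.le (abs_nlsProfile_le_one hp)
  rw [← integral_deriv_nlsProfile_sq_eq_cost hp]
  simp_rw [deriv_nlsProfile_sq hp]
  rw [integral_const_mul, integral_sub hu.2.1 hi, integral_abs_nlsProfile_rpow hp]
  have hp0 : 0 < p := by linarith
  field_simp
  ring

lemma homNLSenergy_nlsProfile (hp : 2 < p) :
    homNLSenergy p (nlsProfile p) =
      (p - 6) / (p * (p + 2)) * ∫ x, nlsProfile p x ^ 2 := by
  rw [(inH1mass_nlsProfile hp).homNLSenergy_eq hp.le (abs_nlsProfile_le_one hp),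
    integral_deriv_nlsProfile_sq_eq_cost hp, two_mul_nlsCost_one hp,
    integral_abs_nlsProfile_rpow hp]
  have hp0 : 0 < p := by linarith
  field_simp
  ring

/-! ### Minimality -/

lemma rpow_le_weighted_rpow (hp2 : 2 < p) (hp6 : p < 6) {M : ℝ} (hM : 0 ≤ M) :
    M ^ (p - 2) ≤ 2 * (p - 2) / (p + 2) * M ^ ((p + 2) / 2) + (6 - p) / (p + 2) := by
  have h := Real.geom_mean_le_arith_mean2_weighted (w₁ := 2 * (p - 2) / (p + 2))
    (w₂ := (6 - p) / (p + 2)) (p₁ := M ^ ((p + 2) / 2)) (p₂ := 1)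
    (div_nonneg (by linarith) (by linarith)) (div_nonneg (by linarith) (by linarith))
    (by positivity) zero_le_one (by field_simp; ring)
  rw [← Real.rpow_mul hM, Real.one_rpow, mul_one, mul_one] at h
  convert h using 2
  field_simp

/-- The profile of height one minimizes the energy at its own mass. -/
lemma homNLSenergy_nlsProfile_le (hp2 : 2 < p) (hp6 : p < 6) {u : ℝ → ℝ}
    (hu : InH1mass (∫ x, nlsProfile p x ^ 2) u) :
    homNLSenergy p (nlsProfile p) ≤ homNLSenergy p u := by
  have hc := integral_nlsProfile_sq_pos hp2
  obtain ⟨x₀, hM, hmax⟩ := hu.exists_abs_max hc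
  set c := ∫ x, nlsProfile p x ^ 2 with hcdef
  set M := |u x₀| with hMdef
  have hM' : 0 < M⁻¹ := inv_pos.2 hM
  have h := (hu.nlsScale (p := p) hM').two_mul_nlsCost_one_le hp2.le
    (a := ((M⁻¹) ^ ((p - 2) / 2))⁻¹ * x₀) (fun x => ?_) ?_
  · rw [homNLSenergy_nlsScale hM', two_mul_nlsCost_one hp2, ← hcdef,
      Real.inv_rpow hM.le, Real.inv_rpow hM.le] at h
    have hsplit : M ^ ((p + 2) / 2) = M ^ (p - 2) * M ^ ((6 - p) / 2) := by
      rw [← Real.rpow_add hM]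
      congr 1
      ring
    have hb : 0 < M ^ (p - 2) := by positivity
    have hd : 0 < M ^ ((6 - p) / 2) := by positivity
    have hw := rpow_le_weighted_rpow hp2 hp6 hM.le
    rw [homNLSenergy_nlsProfile hp2, ← hcdef]
    have hE : M ^ ((p + 2) / 2) * (2 * (p - 2) / (p * (p + 2)) * c) ≤
        homNLSenergy p u + M ^ (p - 2) * (c / p) := by
      refine (mul_le_mul_of_nonneg_left h (by positivity)).trans_eq ?_
      rw [hsplit]
      field_simp
    have hcp : 0 < c / p := div_pos hc (by linarith)
    have hw' := mul_le_mul_of_nonneg_left hw hcp.le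
    have e₁ : c / p * (2 * (p - 2) / (p + 2) * M ^ ((p + 2) / 2) + (6 - p) / (p + 2)) =
        M ^ ((p + 2) / 2) * (2 * (p - 2) / (p * (p + 2)) * c) -
          (p - 6) / (p * (p + 2)) * c := by
      have : 0 < p := by linarith
      field_simp
      ring
    rw [e₁] at hw'
    linarith
  · rw [nlsScale, abs_mul, abs_of_pos hM', inv_mul_le_one₀ hM]
    exact hmax _
  · rw [nlsScale, mul_inv_cancel_left₀ (by positivity), abs_mul, abs_of_pos hM', ← hMdef,
      inv_mul_cancel₀ hM.ne']

end

/-- subcritical homogeneous ground states on ℝ: the level is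
finite, negative, and attained. -/
theorem homogeneous_subcritical_existence
    (p μ : ℝ) (hp2 : 2 < p) (hp6 : p < 6) (hμ : 0 < μ) :
    BddBelow {E : ℝ | ∃ u : ℝ → ℝ, InH1mass μ u ∧ homNLSenergy p u = E} ∧
    sInf {E : ℝ | ∃ u : ℝ → ℝ, InH1mass μ u ∧ homNLSenergy p u = E} < 0 ∧
    ∃ u : ℝ → ℝ, InH1mass μ u ∧
      homNLSenergy p u =
        sInf {E : ℝ | ∃ u : ℝ → ℝ, InH1mass μ u ∧ homNLSenergy p u = E} := by
  have hc := integral_nlsProfile_sq_pos hp2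
  have hprofile := inH1mass_nlsProfile hp2
  have hmin := fun u => homNLSenergy_nlsProfile_le hp2 hp6 (u := u)
  have hneg : homNLSenergy p (nlsProfile p) < 0 := by
    rw [homNLSenergy_nlsProfile hp2]
    exact mul_neg_of_neg_of_pos (div_neg_of_neg_of_pos (by linarith)
      (mul_pos (by linarith) (by linarith))) hc
  set c := ∫ x, nlsProfile p x ^ 2
  obtain ⟨M, hM, hMμ⟩ : ∃ M : ℝ, 0 < M ∧ M ^ ((6 - p) / 2) = μ / c := by
    have hμc : 0 < μ / c := div_pos hμ hc
    refine ⟨(μ / c) ^ ((6 - p) / 2)⁻¹, by positivity, Real.rpow_inv_rpow hμc.le ?_⟩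
    linarith
  have hM' : 0 < M⁻¹ := inv_pos.2 hM
  have hmass : InH1mass μ (nlsScale p M (nlsProfile p)) := by
    have h := hprofile.nlsScale (p := p) hM
    rwa [hMμ, div_mul_cancel₀ _ hc.ne'] at h
  have hleast : IsLeast {E : ℝ | ∃ u : ℝ → ℝ, InH1mass μ u ∧ homNLSenergy p u = E}
      (homNLSenergy p (nlsScale p M (nlsProfile p))) := by
    refine ⟨⟨_, hmass, rfl⟩, ?_⟩
    rintro _ ⟨u, hu, rfl⟩
    have h := hu.nlsScale (p := p) hM'
    rw [Real.inv_rpow hM.le, hMμ, inv_div, div_mul_cancel₀ _ hμ.ne'] at h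
    have h' := hmin _ h
    rw [homNLSenergy_nlsScale hM', Real.inv_rpow hM.le] at h'
    rw [homNLSenergy_nlsScale hM]
    exact (le_inv_mul_iff₀ (by positivity)).1 h'
  have hInf := hleast.csInf_eq
  refine ⟨hleast.bddBelow, ?_, _, hmass, hInf.symm⟩
  rw [hInf, homNLSenergy_nlsScale hM]
  exact mul_neg_of_pos_of_neg (by positivity) hneg
end
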